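/- arXiv:2412.18336 — 6 statements merged into one kernel-verified Lean document; each statement's English description precedes it below -/
import Mathlib

section
/- For every γ with 0 < γ < 1 there exists n₀ ∈ ℕ such that for every n ≥ n₀ the following holds: let G be an n-vertex digraph with minimum total degree δ(G) ≥ (8/5 + γ)n, and let {A, B} be a partition of V(G) such that neither A nor B is an independent set. Then there exist edges a₁a₂ ∈ E(G[A]), b₁b₂ ∈ E(G[B]) and xy ∈ E(G) such that either a₁a₂b₁b₂ or a₁a₂xyb₁b₂ is a 2-path in G. -/
namespace Paper

/-- `G` is a digraph: a loopless directed graph (edges in both directions allowed). -/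
def IsDigraph {n : ℕ} (G : Fin n → Fin n → Prop) : Prop := ∀ v, ¬ G v v

/-- `G` is an oriented graph: no loops and at most one directed edge per pair. -/
def IsOriented {n : ℕ} (G : Fin n → Fin n → Prop) : Prop := ∀ u v, G u v → ¬ G v u

/-- Out-degree of `v` in `G`. -/
noncomputable def outDeg {n : ℕ} (G : Fin n → Fin n → Prop) (v : Fin n) : ℕ :=
  {w | G v w}.ncard

/-- In-degree of `v` in `G`. -/
noncomputable def inDeg {n : ℕ} (G : Fin n → Fin n → Prop) (v : Fin n) : ℕ :=
  {w | G w v}.ncard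

/-- `G` contains the `k`-th power of a Hamilton cycle: a cyclic ordering `f` of all the
vertices such that each vertex sends an edge to the next `k` vertices (indices mod `n`). -/
def HasPowHamCycle {n : ℕ} (k : ℕ) (G : Fin n → Fin n → Prop) : Prop :=
  ∃ f : Fin n ≃ Fin n, ∀ (i : Fin n) (j : ℕ), 1 ≤ j → j ≤ k →
    G (f i) (f ⟨((i : ℕ) + j) % n, Nat.mod_lt _ (Nat.lt_of_le_of_lt (Nat.zero_le _) i.isLt)⟩)

/-- `P` is a `k`-path in `G` (the `k`-th power of a directed path): a list of distinct
vertices in which every vertex sends an edge to each of the next `k` vertices. -/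
def IsKPath {n : ℕ} (k : ℕ) (G : Fin n → Fin n → Prop) (P : List (Fin n)) : Prop :=
  P.Nodup ∧ ∀ i j : Fin P.length, (i : ℕ) < (j : ℕ) → (j : ℕ) ≤ (i : ℕ) + k →
    G (P.get i) (P.get j)

open Finset

section Linking

variable {V : Type*}

/-- Every vertex misses fewer than `2|V|/5` of its potential in- and out-edges: the vertex itself
counts as a missed in-neighbour and as a missed out-neighbour. -/
def FewMissing [Fintype V] (G : V → V → Prop) : Prop :=
  ∀ (v : V) (S T : Finset V), (∀ w ∈ S, ¬ G v w) → (∀ w ∈ T, ¬ G w v) →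
    5 * (#S + #T) < 2 * Fintype.card V

/-- A `2`-path on four vertices with colour pattern `AABB`. -/
def ShortLink (G : V → V → Prop) (A B : Finset V) : Prop :=
  ∃ a₁ ∈ A, ∃ a₂ ∈ A, ∃ b₁ ∈ B, ∃ b₂ ∈ B,
    G a₁ a₂ ∧ G a₁ b₁ ∧ G a₂ b₁ ∧ G a₂ b₂ ∧ G b₁ b₂

/-- A `2`-path on six vertices with colour pattern `AABABB`. -/
def LongLink (G : V → V → Prop) (A B : Finset V) : Prop :=
  ∃ a₁ ∈ A, ∃ a₂ ∈ A, ∃ x ∈ B, ∃ y ∈ A, ∃ b₁ ∈ B, ∃ b₂ ∈ B, a₁ ≠ y ∧ x ≠ b₂ ∧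
    G a₁ a₂ ∧ G a₁ x ∧ G a₂ x ∧ G a₂ y ∧ G x y ∧ G x b₁ ∧ G y b₁ ∧ G y b₂ ∧ G b₁ b₂

variable {G : V → V → Prop} {A B : Finset V}

lemma ShortLink.of_flip (h : ShortLink (flip G) B A) : ShortLink G A B := by
  obtain ⟨b₂, hb₂, b₁, hb₁, a₂, ha₂, a₁, ha₁, h₁, h₂, h₃, h₄, h₅⟩ := h
  exact ⟨a₁, ha₁, a₂, ha₂, b₁, hb₁, b₂, hb₂, h₅, h₄, h₃, h₂, h₁⟩

variable [Fintype V]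

lemma FewMissing.flip (h : FewMissing G) : FewMissing (flip G) := fun v S T hS hT => by
  have := h v T S hT hS
  omega

lemma FewMissing.card_lt_of_independent (h : FewMissing G) [Nonempty V] {I : Finset V}
    (hI : ∀ u ∈ I, ∀ w ∈ I, ¬ G u w) : 5 * #I < Fintype.card V := by
  rcases I.eq_empty_or_nonempty with rfl | ⟨v, hv⟩
  · simpa using Fintype.card_pos
  · have := h v I I (hI v hv) fun w hw => hI w hw v hv
    omega

open Classical in
/-- If the in-neighbourhood of `b` in `A` has at most `|V|/5` vertices, then an edge inside it
extends to a `2`-path of pattern `AABB`. -/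
lemma FewMissing.card_lt_of_edge (h : FewMissing G)
    (hcard : Fintype.card V ≤ #A + #B) (hlink : ¬ ShortLink G A B) {b a₁ a₂ : V} (hb : b ∈ B)
    (ha₁ : a₁ ∈ A) (ha₂ : a₂ ∈ A) (h₁₂ : G a₁ a₂) (h₁ : G a₁ b) (h₂ : G a₂ b) :
    Fintype.card V < 5 * #{a ∈ A | G a b} := by
  have hsub : B ⊆ ({w ∈ B | ¬ G a₂ w} : Finset V) ∪ ({w | ¬ G b w} : Finset V) := by
    intro w hw
    by_contra hcon
    simp only [mem_union, mem_filter, mem_univ, true_and, not_or, not_and, not_not] at hcon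
    exact hlink ⟨a₁, ha₁, a₂, ha₂, b, hb, w, hw, h₁₂, h₁, h₂, hcon.1 hw, hcon.2⟩
  have hB := (card_le_card hsub).trans (card_union_le _ _)
  have hma := h a₂ {w ∈ B | ¬ G a₂ w} ∅ (by simp) (by simp)
  have hmb := h b {w | ¬ G b w} {w ∈ A | ¬ G w b} (by simp) (by simp)
  have hA := card_filter_add_card_filter_not (s := A) (fun a => G a b)
  simp only [card_empty] at hma
  omega

open Classical in
/-- Two vertices whose common in-neighbourhood in `A` has at most `|V|/5` vertices have a common
neighbour outside `A`, joined to both in both directions. -/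
lemma FewMissing.exists_common_neighbor (h : FewMissing G)
    (hcover : ∀ v, v ∈ A ∨ v ∈ B) {b c : V}
    (hcard : 5 * #{a ∈ A | G a b ∧ G a c} ≤ Fintype.card V) :
    ∃ d ∈ B, G b d ∧ G d b ∧ G c d ∧ G d c := by
  by_contra! hcon
  have hsub : (univ : Finset V) ⊆ {a ∈ A | G a b ∧ G a c} ∪
      ((({w | ¬ G b w} : Finset V) ∪ ({w | ¬ G w b} : Finset V)) ∪
        (({w | ¬ G c w} : Finset V) ∪ ({w | ¬ G w c} : Finset V))) := by
    intro w _
    simp only [mem_union, mem_filter, mem_univ, true_and]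
    have := hcover w
    have := hcon w
    tauto
  have h₀ := (card_le_card hsub).trans (card_union_le _ _)
  have h₁ := card_union_le (({w | ¬ G b w} : Finset V) ∪ ({w | ¬ G w b} : Finset V))
    (({w | ¬ G c w} : Finset V) ∪ ({w | ¬ G w c} : Finset V))
  have h₂ := card_union_le ({w | ¬ G b w} : Finset V) ({w | ¬ G w b} : Finset V)
  have h₃ := card_union_le ({w | ¬ G c w} : Finset V) ({w | ¬ G w c} : Finset V)
  have hb := h b {w | ¬ G b w} {w | ¬ G w b} (by simp) (by simp)
  have hc := h c {w | ¬ G c w} {w | ¬ G w c} (by simp) (by simp)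
  rw [card_univ] at h₀
  omega

open Classical in
/-- Some vertex of `B` has an independent in-neighbourhood in `A`. -/
lemma FewMissing.exists_independent_inNeighbors (h : FewMissing G)
    (hcover : ∀ v, v ∈ A ∨ v ∈ B) (hcard : Fintype.card V ≤ #A + #B)
    (hlink : ¬ ShortLink G A B) (hB : ∃ u ∈ B, ∃ w ∈ B, G u w) :
    ∃ b ∈ B, ∀ u ∈ A, ∀ w ∈ A, G u b → G w b → ¬ G u w := by
  by_contra! hcon
  have hlarge : ∀ b ∈ B, Fintype.card V < 5 * #{a ∈ A | G a b} := by
    intro b hb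
    obtain ⟨u, hu, w, hw, hub, hwb, huw⟩ := hcon b hb
    exact h.card_lt_of_edge hcard hlink hb hu hw huw hub hwb
  have hsource : ∀ b ∈ B, ∀ c ∈ B, G b c → ∀ z ∈ A, ∀ y ∈ A, G z b → G y b → G y c →
      ¬ G z y := fun b hb c hc hbc z hz y hy hzb hyb hyc hzy =>
    hlink ⟨z, hz, y, hy, b, hb, c, hc, hzy, hzb, hyb, hyc, hbc⟩
  have hdisj : ∀ b ∈ B, ∀ c ∈ B, G b c → G c b → ∀ y ∈ A, G y b → ¬ G y c := by
    intro b hb c hc hbc hcb y hy hyb hyc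
    have hm := h y ({a ∈ A | G a b} ∩ {a ∈ A | G a c}) ({a ∈ A | G a b} ∪ {a ∈ A | G a c})
      (fun w hw => by
        simp only [mem_inter, mem_filter] at hw
        exact hsource b hb c hc hbc y hy w hw.1.1 hyb hw.1.2 hw.2.2)
      (fun w hw => by
        simp only [mem_union, mem_filter] at hw
        rcases hw with hw | hw
        · exact hsource b hb c hc hbc w hw.1 y hy hw.2 hyb hyc
        · exact hsource c hc b hb hcb w hw.1 y hy hw.2 hyc hyb)
    have := card_inter_add_card_union ({a ∈ A | G a b}) ({a ∈ A | G a c})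
    have := hlarge b hb
    have := hlarge c hc
    omega
  obtain ⟨b, hb, c, hc, hbc⟩ := hB
  have hsmall : 5 * #{a ∈ A | G a b ∧ G a c} ≤ Fintype.card V := by
    rcases ({a ∈ A | G a b ∧ G a c}).eq_empty_or_nonempty with h₀ | ⟨y, hy⟩
    · simp [h₀]
    · rw [mem_filter] at hy
      have hm := h y {a ∈ A | G a b ∧ G a c} {a ∈ A | G a b}
        (fun w hw => by
          rw [mem_filter] at hw
          exact hsource b hb c hc hbc y hy.1 w hw.1 hy.2.1 hw.2.1 hw.2.2)
        (fun w hw => by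
          rw [mem_filter] at hw
          exact hsource b hb c hc hbc w hw.1 y hy.1 hw.2 hy.2.1 hy.2.2)
      have := hlarge b hb
      omega
  obtain ⟨d, hd, hbd, hdb, -, -⟩ := h.exists_common_neighbor hcover hsmall
  have hempty : 5 * #{a ∈ A | G a b ∧ G a d} ≤ Fintype.card V := by
    rw [filter_false_of_mem fun y hy hyy => hdisj b hb d hd hbd hdb y hy hyy.1 hyy.2]
    simp
  obtain ⟨e, he, hbe, heb, hde, hed⟩ := h.exists_common_neighbor hcover hempty
  have hdisjoint : ∀ p ∈ B, ∀ q ∈ B, G p q → G q p →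
      Disjoint ({a ∈ A | G a p}) ({a ∈ A | G a q}) := fun p hp q hq hpq hqp =>
    disjoint_filter.2 fun y hy => hdisj p hp q hq hpq hqp y hy
  have hunion : #{a ∈ A | G a b} + #{a ∈ A | G a d} + #{a ∈ A | G a e} ≤ #A := by
    rw [← card_union_of_disjoint (hdisjoint b hb d hd hbd hdb), ← card_union_of_disjoint
      (disjoint_union_left.2 ⟨hdisjoint b hb e he hbe heb, hdisjoint d hd e he hde hed⟩)]
    exact card_le_card (union_subset (union_subset (filter_subset _ _) (filter_subset _ _))
      (filter_subset _ _))
  have hmiss : ∀ p, 5 * #{a ∈ A | ¬ G a p} < 2 * Fintype.card V := fun p => by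
    simpa using h p ∅ {a ∈ A | ¬ G a p} (by simp) (by simp)
  have hsplit : ∀ p, #{a ∈ A | G a p} + #{a ∈ A | ¬ G a p} = #A := fun p =>
    card_filter_add_card_filter_not _
  have := hlarge b hb
  have := hlarge d hd
  have := hlarge e he
  have := hmiss b
  have := hmiss d
  have := hmiss e
  have := hsplit b
  have := hsplit d
  have := hsplit e
  omega

open Classical in
/-- If `N⁺(a) ∩ B` has at most `|V|/5` vertices, then `a` and any other vertex have a common
in-neighbour in `A`. -/
lemma FewMissing.exists_common_inNeighbor (h : FewMissing G)
    (hcard : Fintype.card V ≤ #A + #B) {a : V} (x : V)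
    (ha : 5 * #{w ∈ B | G a w} ≤ Fintype.card V) : ∃ a' ∈ A, G a' a ∧ G a' x := by
  by_contra! hcon
  have hsub : A ⊆ ({w | ¬ G w a} : Finset V) ∪ ({w | ¬ G w x} : Finset V) := by
    intro w hw
    simp only [mem_union, mem_filter, mem_univ, true_and]
    have := hcon w hw
    tauto
  have hA := (card_le_card hsub).trans (card_union_le _ _)
  have hma := h a {w ∈ B | ¬ G a w} {w | ¬ G w a} (by simp) (by simp)
  have hmx := h x ∅ {w | ¬ G w x} (by simp) (by simp)
  have hB := card_filter_add_card_filter_not (s := B) (fun w => G a w)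
  simp only [card_empty] at hmx
  omega

open Classical in
lemma FewMissing.shortLink_or_longLink (h : FewMissing G)
    (hcover : ∀ v, v ∈ A ∨ v ∈ B)
    (hA : ∃ u ∈ A, ∃ w ∈ A, G u w) (hB : ∃ u ∈ B, ∃ w ∈ B, G u w) :
    ShortLink G A B ∨ LongLink G A B := by
  by_contra! hcon
  obtain ⟨hshort, hlong⟩ := hcon
  have hcard : Fintype.card V ≤ #A + #B := by
    rw [← card_univ]
    refine (card_le_card fun v _ => ?_).trans (card_union_le A B)
    simpa using hcover v
  obtain ⟨b, hb, hindb⟩ := h.exists_independent_inNeighbors hcover hcard hshort hB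
  obtain ⟨a, ha, hinda⟩ := h.flip.exists_independent_inNeighbors (A := B) (B := A)
    (fun v => (hcover v).symm) (by omega) (fun hl => hshort hl.of_flip)
    (by obtain ⟨u, hu, w, hw, huw⟩ := hA; exact ⟨w, hw, u, hu, huw⟩)
  replace hinda : ∀ u ∈ B, ∀ w ∈ B, G a u → G a w → ¬ G u w :=
    fun u hu w hw hau haw huw => hinda w hw u hu haw hau huw
  have : Nonempty V := ⟨a⟩
  have hF : 5 * #{w ∈ B | G a w} < Fintype.card V := h.card_lt_of_independent fun u hu w hw => by
    rw [mem_filter] at hu hw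
    exact hinda u hu.1 w hw.1 hu.2 hw.2
  have hH : 5 * #{w ∈ A | G w b} < Fintype.card V := h.card_lt_of_independent fun u hu w hw => by
    rw [mem_filter] at hu hw
    exact hindb u hu.1 w hw.1 hu.2 hw.2
  have hyx : ∀ y ∈ A, ∀ x ∈ B, G a y → G y b → G a x → G x b → ¬ G y x :=
    fun y hy x hx hay hyb hax hxb hyx =>
      hshort ⟨a, ha, y, hy, x, hx, b, hb, hay, hax, hyx, hyb, hxb⟩
  have hxy : ∀ x ∈ B, ∀ y ∈ A, G a y → G y b → G a x → G x b → ¬ G x y := by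
    intro x hx y hy hay hyb hax hxb hxy
    obtain ⟨a', ha', haa, hax'⟩ := h.exists_common_inNeighbor hcard x hF.le
    obtain ⟨b', hb', hbb, hyb'⟩ := h.flip.exists_common_inNeighbor (A := B) (B := A) (a := b)
      (by omega) y hH.le
    refine hlong ⟨a', ha', a, ha, x, hx, y, hy, b, hb, b', hb', ?_, ?_, haa, hax', hax, hay, hxy,
      hxb, hyb, hyb', hbb⟩
    · rintro rfl
      exact hyx _ hy _ hx hay hyb hax hxb hax'
    · rintro rfl
      exact hyx _ hy _ hx hay hyb hax hxb hyb'
  have hind : 5 * #({w | G a w ∧ G w b} : Finset V) < Fintype.card V := by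
    refine h.card_lt_of_independent fun u hu w hw => ?_
    simp only [mem_filter, mem_univ, true_and] at hu hw
    rcases hcover u with hu' | hu' <;> rcases hcover w with hw' | hw'
    · exact hindb u hu' w hw' hu.2 hw.2
    · exact hyx u hu' w hw' hu.1 hu.2 hw.1 hw.2
    · exact hxy u hu' w hw' hw.1 hw.2 hu.1 hu.2
    · exact hinda u hu' w hw' hu.1 hw.1
  have hsub : (univ : Finset V) ⊆ ({w | G a w ∧ G w b} : Finset V) ∪
      (({w | ¬ G a w} : Finset V) ∪ ({w | ¬ G w b} : Finset V)) := by
    intro w _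
    simp only [mem_union, mem_filter, mem_univ, true_and]
    tauto
  have h₀ := (card_le_card hsub).trans (card_union_le _ _)
  have h₁ := card_union_le ({w | ¬ G a w} : Finset V) ({w | ¬ G w b} : Finset V)
  have hma := h a {w | ¬ G a w} ∅ (by simp) (by simp)
  have hmb := h b ∅ {w | ¬ G w b} (by simp) (by simp)
  rw [card_univ] at h₀
  simp only [card_empty] at hma hmb
  omega

end Linking

lemma fewMissing_of_degree {n : ℕ} {G : Fin n → Fin n → Prop}
    (h : ∀ v, 8 * n < 5 * (outDeg G v + inDeg G v)) : FewMissing G := by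
  have key : ∀ (P : Fin n → Prop) (S : Finset (Fin n)), (∀ w ∈ S, ¬ P w) →
      {w | P w}.ncard + #S ≤ n := by
    classical
    intro P S hS
    rw [Set.ncard_eq_toFinset_card', ← card_union_of_disjoint]
    · simpa using card_le_univ ({w | P w}.toFinset ∪ S)
    · exact disjoint_left.2 fun w hw hwS => hS w hwS (by simpa using hw)
  intro v S T hS hT
  have h₁ := key (fun w => G v w) S hS
  have h₂ := key (fun w => G w v) T hT
  have h₃ := h v
  unfold outDeg inDeg at h₃
  rw [Fintype.card_fin]
  omega

/-- For every `0 < γ < 1` there is `n₀` such that for every digraph `G` on `n ≥ n₀`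
vertices with minimum total degree at least `(8/5 + γ)n` and every partition `{A, B}` of
the vertex set with neither part independent, there are edges `a₁a₂` inside `A`, `b₁b₂`
inside `B` and `xy` in `G` such that `a₁a₂b₁b₂` or `a₁a₂xyb₁b₂` is a `2`-path. -/
theorem statement_8 (γ : ℝ) (hγ0 : 0 < γ) (hγ1 : γ < 1) :
    ∃ n₀ : ℕ, ∀ n : ℕ, n₀ ≤ n → ∀ G : Fin n → Fin n → Prop, IsDigraph G →
      (∀ v, (8/5 + γ) * n ≤ ((outDeg G v + inDeg G v : ℕ) : ℝ)) →
      ∀ A B : Set (Fin n), A ∪ B = Set.univ → A ∩ B = ∅ →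
        (∃ u ∈ A, ∃ w ∈ A, G u w) → (∃ u ∈ B, ∃ w ∈ B, G u w) →
        ∃ a₁ a₂ b₁ b₂ : Fin n, a₁ ∈ A ∧ a₂ ∈ A ∧ G a₁ a₂ ∧ b₁ ∈ B ∧ b₂ ∈ B ∧ G b₁ b₂ ∧
          (IsKPath 2 G [a₁, a₂, b₁, b₂] ∨
            ∃ x y : Fin n, G x y ∧ IsKPath 2 G [a₁, a₂, x, y, b₁, b₂]) := by
  classical
  refine ⟨1, fun n hn G hG hdeg A B hAB hdisj hA hB => ?_⟩
  have hfew : FewMissing G := fewMissing_of_degree fun v => by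
    have hn' : (1 : ℝ) ≤ n := by exact_mod_cast hn
    have := hdeg v
    have hlt : (8 * n : ℝ) < 5 * (outDeg G v + inDeg G v : ℕ) := by nlinarith
    exact_mod_cast hlt
  have hne : ∀ a ∈ A, ∀ b ∈ B, a ≠ b := by
    rintro a ha _ hb rfl
    exact (hdisj ▸ ⟨ha, hb⟩ : a ∈ (∅ : Set (Fin n)))
  have hloop : ∀ {u w}, G u w → u ≠ w := by
    rintro u _ h rfl
    exact hG u h
  have hlinks := hfew.shortLink_or_longLink (A := A.toFinset) (B := B.toFinset)
    (fun v => by simpa using (hAB ▸ Set.mem_univ v : v ∈ A ∪ B)) (by simpa using hA)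
    (by simpa using hB)
  rcases hlinks with
    ⟨a₁, ha₁, a₂, ha₂, b₁, hb₁, b₂, hb₂, h₁, h₂, h₃, h₄, h₅⟩ |
    ⟨a₁, ha₁, a₂, ha₂, x, hx, y, hy, b₁, hb₁, b₂, hb₂, hay, hxb, h₁, h₂, h₃, h₄, h₅, h₆, h₇, h₈,
      h₉⟩
  · rw [Set.mem_toFinset] at ha₁ ha₂ hb₁ hb₂
    refine ⟨a₁, a₂, b₁, b₂, ha₁, ha₂, h₁, hb₁, hb₂, h₅, Or.inl ⟨?_, ?_⟩⟩
    · simp [hloop h₁, hloop h₅, hne _ ha₁ _ hb₁, hne _ ha₁ _ hb₂, hne _ ha₂ _ hb₁,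
        hne _ ha₂ _ hb₂]
    · intro i j hij hjk
      fin_cases i <;> fin_cases j <;> simp_all
  · rw [Set.mem_toFinset] at ha₁ ha₂ hb₁ hb₂ hx hy
    refine ⟨a₁, a₂, b₁, b₂, ha₁, ha₂, h₁, hb₁, hb₂, h₉, Or.inr ⟨x, y, h₅, ?_, ?_⟩⟩
    · simp [hloop h₁, hloop h₄, hloop h₆, hloop h₉, hay, hxb, hne _ ha₁ _ hb₁, hne _ ha₁ _ hb₂,
        hne _ ha₂ _ hb₁, hne _ ha₂ _ hb₂, hne _ ha₁ _ hx, hne _ ha₂ _ hx, hne _ hy _ hb₁,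
        hne _ hy _ hb₂, (hne _ hy _ hx).symm]
    · intro i j hij hjk
      fin_cases i <;> fin_cases j <;> simp_all

end Paper
end

section
/- For every γ with 0 < γ < 1 there exists n₀ ∈ ℕ such that for every n ≥ n₀ the following holds: if G is an n-vertex digraph with minimum total degree δ(G) ≥ (8/5 + γ)n, then for every pair of vertex-disjoint edges ab, yz ∈ E(G) there exists a 2-path x₁x₂…x_{ℓ−1}x_ℓ in G of length ℓ ≤ 20 with x₁ = a, x₂ = b, x_{ℓ−1} = y and x_ℓ = z. -/
namespace Paper

/-- The list `l` is a walk in `G` in which every vertex sends an edge to the next two entries;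
entries may repeat. -/
def IsSqWalk {V : Type*} (G : V → V → Prop) : List V → Prop
  | a :: b :: c :: l => G a b ∧ G a c ∧ IsSqWalk G (b :: c :: l)
  | [a, b] => G a b
  | _ => True

lemma IsSqWalk.adj {V : Type*} {G : V → V → Prop} {l : List V} (h : IsSqWalk G l) :
    ∀ (i j : ℕ) (hi : i < l.length) (hj : j < l.length), i < j → j ≤ i + 2 → G l[i] l[j] := by
  induction l using IsSqWalk.induct with
  | case1 a b c l ih =>
    obtain ⟨h1, h2, h3⟩ := h
    intro i j hi hj hij hij2
    rcases i with _ | i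
    · obtain rfl | rfl : j = 1 ∨ j = 2 := by omega
      · simpa using h1
      · simpa using h2
    · rcases j with _ | j
      · omega
      · have := ih h3 i j (by simpa using hi) (by simpa using hj) (by omega) (by omega)
        simpa using this
  | case2 a b =>
    intro i j hi hj hij hij2
    obtain ⟨rfl, rfl⟩ : i = 0 ∧ j = 1 := by simp at hi hj; omega
    exact h
  | case3 l h1 h2 =>
    intro i j hi hj hij hij2
    match l, h1, h2 with
    | [], _, _ => simp at hi
    | [a], _, _ => simp at hi hj; omega
    | [a, b], _, h2 => exact (h2 a b rfl).elim
    | a :: b :: c :: l, h1, _ => exact (h1 a b c l rfl).elim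

/-- Two square walks overlapping in two consecutive entries can be glued. -/
lemma IsSqWalk.glue {V : Type*} {G : V → V → Prop} {u v : V} {B : List V} :
    ∀ {A : List V}, IsSqWalk G (A ++ [u, v]) → IsSqWalk G (u :: v :: B) →
      IsSqWalk G (A ++ u :: v :: B)
  | [], _, h => h
  | [_], h, h' => ⟨h.1, h.2.1, h'⟩
  | [_, _], h, h' => ⟨h.1, h.2.1, h.2.2.1, h.2.2.2.1, h'⟩
  | _ :: b :: c :: A, h, h' => ⟨h.1, h.2.1, IsSqWalk.glue (A := b :: c :: A) h.2.2 h'⟩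

lemma IsSqWalk.reverse {V : Type*} {G : V → V → Prop} {l : List V}
    (h : IsSqWalk (fun u v => G v u) l) : IsSqWalk G l.reverse := by
  induction l using IsSqWalk.induct with
  | case1 a b c l ih =>
    obtain ⟨h1, h2, h3⟩ := h
    have h4 := ih h3
    simp only [List.reverse_cons, List.append_assoc, List.cons_append, List.nil_append] at h4 ⊢
    refine h4.glue ⟨?_, h2, h1⟩
    rcases l with _ | ⟨d, l⟩
    · exact h3
    · exact h3.1
  | case2 a b => exact h
  | case3 l h1 h2 =>
    match l, h1, h2 with
    | [], _, _ => trivial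
    | [a], _, _ => trivial
    | [a, b], _, h2 => exact (h2 a b rfl).elim
    | a :: b :: c :: l, h1, _ => exact (h1 a b c l rfl).elim

/-- A labelled list whose labels are square walks under every assignment in a family is sent to a
square walk by any map whose edges are all witnessed by the family. -/
lemma IsSqWalk.lift {V I E U : Type*} {G : V → V → Prop} (lab : E → I) (u : U → I → V)
    (val : E → V)
    (hval : ∀ e e', (∀ k, G (u k (lab e)) (u k (lab e'))) → G (val e) (val e')) {l : List E}
    (h : ∀ k, IsSqWalk G (l.map fun e => u k (lab e))) : IsSqWalk G (l.map val) := by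
  induction l using IsSqWalk.induct with
  | case1 a b c l ih =>
    exact ⟨hval _ _ fun k => (h k).1, hval _ _ fun k => (h k).2.1, ih fun k => (h k).2.2⟩
  | case2 a b => exact hval _ _ fun k => h k
  | case3 l h1 h2 =>
    match l, h1, h2 with
    | [], _, _ => trivial
    | [a], _, _ => trivial
    | [a, b], _, h2 => exact (h2 a b rfl).elim
    | a :: b :: c :: l, h1, _ => exact (h1 a b c l rfl).elim

open Classical in
/-- The indicator of the edge `uv`. -/
noncomputable def arc {V : Type*} (G : V → V → Prop) (u v : V) : ℕ := if G u v then 1 else 0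

lemma arc_le_one {V : Type*} (G : V → V → Prop) (u v : V) : arc G u v ≤ 1 := by
  unfold arc; split_ifs <;> simp

lemma adj_of_arc {V : Type*} {G : V → V → Prop} {u v : V} (h : 1 ≤ arc G u v) : G u v := by
  unfold arc at h; split_ifs at h with h'
  · exact h'
  · simp at h

/-- `u` and `v` are joined by edges in both directions. -/
def Bi {V : Type*} (G : V → V → Prop) (u v : V) : Prop := G u v ∧ G v u

lemma Bi.symm {V : Type*} {G : V → V → Prop} {u v : V} (h : Bi G u v) : Bi G v u := ⟨h.2, h.1⟩

/-- The number of edges in either direction between `q` and the vertices `p, c, d, x, t`. -/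
noncomputable def arcsTo {V : Type*} (G : V → V → Prop) (p c d x t q : V) : ℕ :=
  arc G p q + arc G q p + (arc G c q + arc G q c) + (arc G d q + arc G q d) +
    (arc G x q + arc G q x) + (arc G t q + arc G q t)

/-- If `q` misses at most one edge to `p, c, d, x, t`, then one of four short patterns, each
carrying a square walk through `p` and `q` from `cd` to `xt`, is present. -/
lemma arcsTo_cases {V : Type*} {G : V → V → Prop} {p c d x t q : V}
    (h : 9 ≤ arcsTo G p c d x t q) :
    (G c q ∧ G d q ∧ G q p ∧ G q x) ∨ (G d q ∧ G p q ∧ G q x ∧ G q t) ∨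
      (G p q ∧ G c q ∧ G q p ∧ G q x) ∨ (G d q ∧ G p q ∧ G q t ∧ G q p) := by
  unfold arcsTo at h
  have h1 := arc_le_one G p q
  have h2 := arc_le_one G q p
  have h3 := arc_le_one G c q
  have h4 := arc_le_one G q c
  have h5 := arc_le_one G d q
  have h6 := arc_le_one G q d
  have h7 := arc_le_one G x q
  have h8 := arc_le_one G q x
  have h9 := arc_le_one G t q
  have h10 := arc_le_one G q t
  have key : (1 ≤ arc G c q ∧ 1 ≤ arc G d q ∧ 1 ≤ arc G q p ∧ 1 ≤ arc G q x) ∨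
      (1 ≤ arc G d q ∧ 1 ≤ arc G p q ∧ 1 ≤ arc G q x ∧ 1 ≤ arc G q t) ∨
      (1 ≤ arc G p q ∧ 1 ≤ arc G c q ∧ 1 ≤ arc G q p ∧ 1 ≤ arc G q x) ∨
      (1 ≤ arc G d q ∧ 1 ≤ arc G p q ∧ 1 ≤ arc G q t ∧ 1 ≤ arc G q p) := by omega
  refine key.imp ?_ (Or.imp ?_ (Or.imp ?_ ?_)) <;> rintro ⟨a1, a2, a3, a4⟩ <;>
    exact ⟨adj_of_arc a1, adj_of_arc a2, adj_of_arc a3, adj_of_arc a4⟩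

section Bowtie

variable {V : Type*} {G : V → V → Prop} {p c d x t q : V}

/-- In a bowtie of bidirected triangles `pcd` and `pxt`, a vertex `q` missing at most one edge to it
connects `cd` to `xt`. -/
lemma exists_bowtie_walk (hcd : Bi G c d) (hcp : Bi G c p) (hdp : Bi G d p) (hpx : Bi G p x)
    (hpt : Bi G p t) (hxt : Bi G x t) (h : 9 ≤ arcsTo G p c d x t q) :
    ∃ L : List V, L.length ≤ 4 ∧ (∀ v ∈ L, v ∈ [c, d, p, x, t, q]) ∧
      IsSqWalk G (c :: d :: (L ++ [x, t])) := by
  obtain ⟨_, _⟩ := hcd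
  obtain ⟨_, _⟩ := hcp
  obtain ⟨_, _⟩ := hdp
  obtain ⟨_, _⟩ := hpx
  obtain ⟨_, _⟩ := hpt
  obtain ⟨_, _⟩ := hxt
  rcases arcsTo_cases h with ⟨_, _, _, _⟩ | ⟨_, _, _, _⟩ | ⟨_, _, _, _⟩ | ⟨_, _, _, _⟩
  · exact ⟨[q, p], by simp, by simp, by simp [IsSqWalk, *]⟩
  · exact ⟨[p, q], by simp, by simp, by simp [IsSqWalk, *]⟩
  · exact ⟨[p, c, q, p], by simp, by simp, by simp [IsSqWalk, *]⟩
  · exact ⟨[p, q, t, p], by simp, by simp, by simp [IsSqWalk, *]⟩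

/-- Variant of `exists_bowtie_walk` ending in the edge `px` at the centre of the bowtie. -/
lemma exists_bowtie_walk_from_centre (hcd : Bi G c d) (hcp : Bi G c p) (hdp : Bi G d p)
    (hpx : Bi G p x) (hpt : Bi G p t) (hxt : Bi G x t) (h : 9 ≤ arcsTo G p c d x t q) :
    ∃ L : List V, L.length ≤ 5 ∧ (∀ v ∈ L, v ∈ [c, d, p, x, t, q]) ∧
      IsSqWalk G (c :: d :: (L ++ [p, x])) := by
  obtain ⟨_, _⟩ := hcd
  obtain ⟨_, _⟩ := hcp
  obtain ⟨_, _⟩ := hdp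
  obtain ⟨_, _⟩ := hpx
  obtain ⟨_, _⟩ := hpt
  obtain ⟨_, _⟩ := hxt
  rcases arcsTo_cases h with ⟨_, _, _, _⟩ | ⟨_, _, _, _⟩ | ⟨_, _, _, _⟩ | ⟨_, _, _, _⟩
  · exact ⟨[q], by simp, by simp, by simp [IsSqWalk, *]⟩
  · exact ⟨[p, q, x, t], by simp, by simp, by simp [IsSqWalk, *]⟩
  · exact ⟨[p, c, q], by simp, by simp, by simp [IsSqWalk, *]⟩
  · exact ⟨[p, q, t], by simp, by simp, by simp [IsSqWalk, *]⟩

/-- Variant of `exists_bowtie_walk` ending in the edge `tp` at the centre of the bowtie. -/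
lemma exists_bowtie_walk_to_centre (hcd : Bi G c d) (hcp : Bi G c p) (hdp : Bi G d p)
    (hpx : Bi G p x) (hpt : Bi G p t) (hxt : Bi G x t) (h : 9 ≤ arcsTo G p c d x t q) :
    ∃ L : List V, L.length ≤ 5 ∧ (∀ v ∈ L, v ∈ [c, d, p, x, t, q]) ∧
      IsSqWalk G (c :: d :: (L ++ [t, p])) := by
  obtain ⟨_, _⟩ := hcd
  obtain ⟨_, _⟩ := hcp
  obtain ⟨_, _⟩ := hdp
  obtain ⟨_, _⟩ := hpx
  obtain ⟨_, _⟩ := hpt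
  obtain ⟨_, _⟩ := hxt
  rcases arcsTo_cases h with ⟨_, _, _, _⟩ | ⟨_, _, _, _⟩ | ⟨_, _, _, _⟩ | ⟨_, _, _, _⟩
  · exact ⟨[q, p, x], by simp, by simp, by simp [IsSqWalk, *]⟩
  · exact ⟨[p, q, x], by simp, by simp, by simp [IsSqWalk, *]⟩
  · exact ⟨[p, c, q, p, x], by simp, by simp, by simp [IsSqWalk, *]⟩
  · exact ⟨[p, q], by simp, by simp, by simp [IsSqWalk, *]⟩

end Bowtie

/-- Two bowties, sharing the triangle `pto`, connect `cd` to the bidirected edge on `{o, r}`, in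
either orientation. -/
lemma exists_walk_of_bowties {V : Type*} {G : V → V → Prop} {c d x w p o r t s q q' : V}
    (hor : (o = x ∧ r = w) ∨ (o = w ∧ r = x)) (hcd : Bi G c d) (hcp : Bi G c p) (hdp : Bi G d p)
    (hpo : Bi G p o) (hxw : Bi G x w) (hpt : Bi G p t) (hot : Bi G o t) (hos : Bi G o s)
    (hrs : Bi G r s) (hq : 9 ≤ arcsTo G p c d o t q) (hq' : 9 ≤ arcsTo G o t p r s q') :
    ∃ L : List V, L.length ≤ 12 ∧ (∀ v ∈ L, v ∈ [c, d, x, w, p, t, s, q, q']) ∧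
      IsSqWalk G (c :: d :: (L ++ [x, w])) := by
  obtain ⟨L₁, hL₁, hm₁, hw₁⟩ := exists_bowtie_walk hcd hcp hdp hpo hpt hot hq
  have hor' : Bi G o r := by
    rcases hor with ⟨rfl, rfl⟩ | ⟨rfl, rfl⟩
    · exact hxw
    · exact hxw.symm
  have h2 : ∃ L : List V, L.length ≤ 5 ∧ (∀ v ∈ L, v ∈ [t, p, o, r, s, q']) ∧
      IsSqWalk G (t :: p :: (L ++ [x, w])) := by
    rcases hor with ⟨rfl, rfl⟩ | ⟨rfl, rfl⟩
    · exact exists_bowtie_walk_from_centre hpt.symm hot.symm hpo hor' hos hrs hq'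
    · obtain ⟨L, h1, h2, h3⟩ := exists_bowtie_walk_to_centre (q := q') (x := s) (t := r)
        hpt.symm hot.symm hpo hos hor' hrs.symm (by unfold arcsTo at hq' ⊢; omega)
      refine ⟨L, h1, fun v hv => ?_, h3⟩
      have := h2 v hv
      simp only [List.mem_cons, List.not_mem_nil, or_false] at this ⊢
      tauto
  obtain ⟨L₂, hL₂, hm₂, hw₂⟩ := h2
  refine ⟨L₁ ++ o :: t :: p :: L₂, by simp; omega, fun v hv => ?_, ?_⟩
  · have hv' : v ∈ L₁ ∨ v = o ∨ v = t ∨ v = p ∨ v ∈ L₂ := by simpa using hv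
    have ho : o = x ∨ o = w := hor.imp And.left And.left
    have hr : r = w ∨ r = x := hor.imp And.right And.right
    have e₁ := hm₁ v
    have e₂ := hm₂ v
    simp only [List.mem_cons, List.not_mem_nil, or_false] at e₁ e₂ ⊢
    clear * - hv' ho hr e₁ e₂
    grind
  · have h3 : IsSqWalk G (o :: t :: p :: (L₂ ++ [x, w])) := ⟨hot.1, hpo.2, hw₂⟩
    have := IsSqWalk.glue (A := c :: d :: L₁) hw₁ h3
    simpa using this

/-- At least `ε n` vertices satisfy `φ`. -/
def Many {n : ℕ} (ε : ℝ) (φ : Fin n → Prop) : Prop := ε * n ≤ ({v | φ v}.ncard : ℝ)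

lemma Many.mono {n : ℕ} {ε : ℝ} {φ ψ : Fin n → Prop} (h : Many ε φ) (H : ∀ v, φ v → ψ v) :
    Many ε ψ :=
  h.trans (by exact_mod_cast Set.ncard_le_ncard H (Set.toFinite _))

lemma many_of_le_sum {n : ℕ} {γ : ℝ} (T : ℕ) (f : Fin n → ℕ) (hf : ∀ v, f v ≤ 10)
    (h : (T + γ) * n ≤ ((∑ v, f v : ℕ) : ℝ)) : Many (γ / 10) fun v => T + 1 ≤ f v := by
  classical
  have h1 : ∑ v, f v ≤ ∑ v : Fin n, (T + 10 * if T + 1 ≤ f v then 1 else 0) :=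
    Finset.sum_le_sum fun v _ => by
      have := hf v
      split_ifs <;> omega
  have h2 : ∑ v : Fin n, (T + 10 * if T + 1 ≤ f v then 1 else 0) =
      n * T + 10 * {v | T + 1 ≤ f v}.ncard := by
    rw [Finset.sum_add_distrib, ← Finset.mul_sum, Finset.sum_boole, Set.ncard_eq_toFinset_card']
    simp
  rw [h2] at h1
  have h3 : ((∑ v, f v : ℕ) : ℝ) ≤ n * T + 10 * ({v | T + 1 ≤ f v}.ncard : ℝ) := by
    exact_mod_cast h1
  unfold Many
  linarith

/-- At least `(ε n) ^ m` tuples satisfy `P`, expressed by nested `Many` quantifiers. -/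
def Rich {n : ℕ} (ε : ℝ) : (m : ℕ) → ((Fin m → Fin n) → Prop) → Prop
  | 0, P => P ![]
  | m + 1, P => Many ε fun v => Rich ε m fun u => P (Matrix.vecCons v u)

lemma ncard_cons {n m : ℕ} (P : (Fin (m + 1) → Fin n) → Prop) :
    {u | P u}.ncard = ∑ v, {u | P (Matrix.vecCons v u)}.ncard := by
  classical
  simp only [Set.ncard_eq_toFinset_card', Set.toFinset_ofPred, Finset.card_filter]
  rw [← (Fin.consEquiv fun _ : Fin (m + 1) => Fin n).sum_comp, Fintype.sum_prod_type]
  rfl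

lemma Rich.le_ncard {n : ℕ} {ε : ℝ} (hε : 0 ≤ ε) {m : ℕ} {P : (Fin m → Fin n) → Prop}
    (h : Rich ε m P) : ε ^ m * n ^ m ≤ ({u | P u}.ncard : ℝ) := by
  classical
  induction m with
  | zero =>
    have : {u | P u} = {![]} := by
      ext u
      rw [Subsingleton.elim u ![]]
      exact iff_of_true h rfl
    simp [this]
  | succ m ih =>
    rw [ncard_cons]
    push_cast
    set S : Set (Fin n) := {v | Rich ε m fun u => P (Matrix.vecCons v u)} with hS
    have h1 : ∑ v : Fin n, (if v ∈ S then ε ^ m * (n : ℝ) ^ m else 0) ≤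
        ∑ v, ({u | P (Matrix.vecCons v u)}.ncard : ℝ) :=
      Finset.sum_le_sum fun v _ => by
        split_ifs with hv
        · exact ih hv
        · positivity
    have h2 : ε * n ≤ (S.ncard : ℝ) := h
    rw [← Finset.sum_filter, Finset.sum_const, nsmul_eq_mul] at h1
    have h3 : (Finset.univ.filter (· ∈ S)).card = S.ncard := by
      rw [Set.ncard_eq_toFinset_card']
      congr 1
      ext; simp
    rw [h3] at h1
    refine le_trans ?_ h1
    calc ε ^ (m + 1) * (n : ℝ) ^ (m + 1) = (ε * n) * (ε ^ m * n ^ m) := by ring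
      _ ≤ _ := by gcongr

/-- In a dense family of sets `A v` some `r` of them, with indices outside a bounded set `F`, have a
large intersection. -/
lemma exists_large_inter (r C : ℕ) {ε : ℝ} (hε : 0 < ε) :
    ∃ ε' : ℝ, 0 < ε' ∧ ∃ N : ℕ, ∀ n : ℕ, N ≤ n → ∀ F : Finset (Fin n), F.card ≤ C →
      ∀ (β : Type) [Fintype β] [Nonempty β] (A : Fin n → Set β),
        ε * n * Fintype.card β ≤ ∑ v, ((A v).ncard : ℝ) →
        ∃ g : Fin r → Fin n, Function.Injective g ∧ (∀ k, g k ∉ F) ∧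
          ε' * Fintype.card β ≤ ({u | ∀ k, u ∈ A (g k)}.ncard : ℝ) := by
  classical
  obtain ⟨K, hK⟩ := exists_nat_gt (4 * r / ε)
  obtain ⟨N, hN⟩ := exists_nat_ge (2 * (K + C) / ε)
  have hK' : 4 * (r : ℝ) < K * ε := by rwa [div_lt_iff₀ hε] at hK
  have hKpos : (0 : ℝ) < K := lt_of_le_of_lt (by positivity) hK
  refine ⟨ε / 4 / 2 ^ K, by positivity, N, fun n hn F hF β _ _ A hA => ?_⟩
  have hM : (0 : ℝ) < Fintype.card β := by exact_mod_cast Fintype.card_pos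
  set M : ℝ := ((Fintype.card β : ℕ) : ℝ) with hMdef
  have hAle (v : Fin n) : ((A v).ncard : ℝ) ≤ M := by
    rw [hMdef, ← Nat.card_eq_fintype_card]
    exact_mod_cast Set.ncard_le_card (A v)
  -- the indices of large sets
  set S : Finset (Fin n) := Finset.univ.filter fun v => ε / 2 * M ≤ (A v).ncard with hS
  have hScard : ε / 2 * n ≤ S.card := by
    have h1 : ∑ v, ((A v).ncard : ℝ) ≤ ∑ v : Fin n, (ε / 2 * M + if v ∈ S then M else 0) :=
      Finset.sum_le_sum fun v _ => by
        split_ifs with hv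
        · have := hAle v
          have : 0 < ε / 2 * M := by positivity
          linarith
        · have : ¬ ε / 2 * M ≤ (A v).ncard := fun h => hv (by simp [hS, h])
          linarith
    rw [Finset.sum_add_distrib, ← Finset.sum_filter] at h1
    simp only [Finset.sum_const, Finset.card_univ, Fintype.card_fin, nsmul_eq_mul,
      Finset.filter_univ_mem] at h1
    have h2 : ε / 2 * n * M ≤ S.card * M := by linarith
    exact le_of_mul_le_mul_right h2 hM
  have hSF : K ≤ (S \ F).card := by
    have h1 : S.card - F.card ≤ (S \ F).card := Finset.le_card_sdiff F S
    have h2 : (K + C : ℝ) ≤ ε / 2 * n := by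
      have h3 : (N : ℝ) ≤ n := by exact_mod_cast hn
      have := hN.trans h3
      rw [div_le_iff₀ hε] at this
      linarith
    have h3 : K + C ≤ S.card := by exact_mod_cast h2.trans hScard
    omega
  obtain ⟨T, hTS, hTcard⟩ := Finset.exists_subset_card_eq hSF
  -- the points lying in at least `r` of the chosen sets
  set B : Finset β := Finset.univ.filter fun u => r ≤ (T.filter fun v => u ∈ A v).card with hB
  have hdouble : ∑ v ∈ T, ((A v).ncard : ℝ) = ∑ u : β, ((T.filter fun v => u ∈ A v).card : ℝ) := by
    have h1 (v : Fin n) : ((A v).ncard : ℝ) = ∑ u : β, if u ∈ A v then (1 : ℝ) else 0 := by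
      rw [Set.ncard_eq_toFinset_card', Finset.sum_boole]
      congr 2
      ext; simp
    simp only [h1, Finset.card_filter]
    rw [Finset.sum_comm]
    push_cast
    rfl
  have hBcard : ε / 4 * M ≤ B.card := by
    have h1 : (K : ℝ) * (ε / 2 * M) ≤ ∑ v ∈ T, ((A v).ncard : ℝ) := by
      rw [← hTcard, ← nsmul_eq_mul]
      refine Finset.card_nsmul_le_sum _ _ _ fun v hv => ?_
      have := (Finset.mem_sdiff.1 (hTS hv)).1
      exact (Finset.mem_filter.1 this).2
    have h2 : ∑ u : β, ((T.filter fun v => u ∈ A v).card : ℝ) ≤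
        ∑ u : β, ((r : ℝ) + if u ∈ B then (K : ℝ) else 0) :=
      Finset.sum_le_sum fun u _ => by
        split_ifs with hu
        · have : (T.filter fun v => u ∈ A v).card ≤ K := hTcard ▸ Finset.card_filter_le _ _
          have : ((T.filter fun v => u ∈ A v).card : ℝ) ≤ K := by exact_mod_cast this
          have : (0 : ℝ) ≤ r := by positivity
          linarith
        · have : (T.filter fun v => u ∈ A v).card ≤ r := by
            by_contra h
            exact hu (by simp only [hB, Finset.mem_filter, Finset.mem_univ, true_and]; omega)
          simpa using this
    rw [Finset.sum_add_distrib, ← Finset.sum_filter] at h2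
    simp only [Finset.sum_const, Finset.card_univ, nsmul_eq_mul, Finset.filter_univ_mem] at h2
    rw [← hMdef] at h2
    have h3 : 4 * (r : ℝ) * M ≤ K * ε * M := by gcongr
    have h4 : K * (ε / 4 * M) ≤ K * (B.card : ℝ) := by linarith
    exact le_of_mul_le_mul_left h4 hKpos
  have hsub (u : β) : ∃ R : Finset (Fin n), u ∈ B →
      R.card = r ∧ R ⊆ T ∧ ∀ v ∈ R, u ∈ A v := by
    by_cases hu : u ∈ B
    · obtain ⟨R, h1, h2⟩ := Finset.exists_subset_card_eq (Finset.mem_filter.1 hu).2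
      exact ⟨R, fun _ => ⟨h2, h1.trans (Finset.filter_subset _ _),
        fun v hv => (Finset.mem_filter.1 (h1 hv)).2⟩⟩
    · exact ⟨∅, fun h => (hu h).elim⟩
  choose R hR using hsub
  have hcard : (T.powerset.card : ℝ) = 2 ^ K := by rw [Finset.card_powerset, hTcard]; norm_cast
  obtain ⟨R₀, -, hR₀⟩ := Finset.exists_le_card_fiber_of_nsmul_le_card_of_maps_to
    (s := B) (t := T.powerset) (f := R) (b := ε / 4 / 2 ^ K * M)
    (fun u hu => Finset.mem_powerset.2 (hR u hu).2.1) (Finset.powerset_nonempty T) (by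
      rw [nsmul_eq_mul, hcard]
      refine le_trans (le_of_eq ?_) hBcard
      field_simp)
  have hpos : 0 < (B.filter fun u => R u = R₀).card := by
    have : (0 : ℝ) < ε / 4 / 2 ^ K * M := by positivity
    exact_mod_cast this.trans_le hR₀
  obtain ⟨u₀, hu₀⟩ := Finset.card_pos.1 hpos
  obtain ⟨hu₀B, rfl⟩ := Finset.mem_filter.1 hu₀
  obtain ⟨hRcard, hRT, -⟩ := hR u₀ hu₀B
  refine ⟨(R u₀).orderEmbOfFin hRcard, ((R u₀).orderEmbOfFin hRcard).injective, fun k => ?_, ?_⟩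
  · have := hTS (hRT ((R u₀).orderEmbOfFin_mem hRcard k))
    exact (Finset.mem_sdiff.1 this).2
  · refine hR₀.trans ?_
    rw [← Set.ncard_coe_finset, Nat.cast_le]
    refine Set.ncard_le_ncard (fun u hu k => ?_) (Set.toFinite _)
    obtain ⟨hu, hu'⟩ := Finset.mem_filter.1 (Finset.mem_coe.1 hu)
    refine (hR u hu).2.2 _ ?_
    rw [hu']
    exact (R u₀).orderEmbOfFin_mem hRcard k

/-- Erdős's theorem on complete `m`-partite hypergraphs: a dense `m`-ary predicate on a large set
holds on all transversals of some disjoint `r`-sets avoiding a given bounded set. -/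
lemma exists_blowup (r m : ℕ) : ∀ (C : ℕ) {ε : ℝ}, 0 < ε →
    ∃ N : ℕ, ∀ n : ℕ, N ≤ n → ∀ F : Finset (Fin n), F.card ≤ C →
      ∀ P : (Fin m → Fin n) → Prop, ε * (n : ℝ) ^ m ≤ ({u | P u}.ncard : ℝ) →
        ∃ w : Fin m → Fin r → Fin n, Function.Injective2 w ∧ (∀ i k, w i k ∉ F) ∧
          ∀ j : Fin m → Fin r, P fun i => w i (j i) := by
  classical
  induction m with
  | zero =>
    intro C ε hε
    refine ⟨0, fun n _ F _ P hP => ⟨fun i => i.elim0, fun i => i.elim0, fun i => i.elim0,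
      fun j => ?_⟩⟩
    have h1 : {u | P u}.ncard ≠ 0 := by
      intro h
      rw [h] at hP
      simp at hP
      linarith
    obtain ⟨u, hu⟩ := Set.nonempty_of_ncard_ne_zero h1
    rwa [Subsingleton.elim (fun i => _) u]
  | succ m ih =>
    intro C ε hε
    obtain ⟨ε', hε', N₁, h₁⟩ := exists_large_inter r C hε
    obtain ⟨N₂, h₂⟩ := ih (C + r) hε'
    refine ⟨max (max N₁ N₂) 1, fun n hn F hF P hP => ?_⟩
    have : Nonempty (Fin n) := ⟨⟨0, by omega⟩⟩
    obtain ⟨g, hg, hgF, hgc⟩ := h₁ n (by omega) F hF (Fin m → Fin n)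
      (fun v => {u | P (Matrix.vecCons v u)}) (by
        rw [ncard_cons] at hP
        push_cast at hP
        refine le_trans (le_of_eq ?_) hP
        simp [pow_succ]
        ring)
    obtain ⟨w, hw, hwF, hwP⟩ := h₂ n (by omega) (F ∪ Finset.univ.image g)
      ((Finset.card_union_le _ _).trans
        (add_le_add hF (Finset.card_image_le.trans (by simp))))
      (fun u => ∀ k, P (Matrix.vecCons (g k) u)) (by simpa using hgc)
    simp only [Finset.mem_union, Finset.mem_image, Finset.mem_univ, true_and, not_or,
      not_exists] at hwF
    refine ⟨Matrix.vecCons g w, ?_, ?_, fun j => ?_⟩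
    · intro i i' k k' h
      induction i using Fin.cases with
      | zero =>
        induction i' using Fin.cases with
        | zero => exact ⟨rfl, hg h⟩
        | succ i' => exact ((hwF i' k').2 k h).elim
      | succ i =>
        induction i' using Fin.cases with
        | zero => exact ((hwF i k).2 k' h.symm).elim
        | succ i' => exact ⟨congrArg _ (hw h).1, (hw h).2⟩
    · intro i k
      induction i using Fin.cases with
      | zero => exact hgF k
      | succ i => exact (hwF i k).1
    · convert hwP (fun i => j i.succ) (j 0) using 1
      ext i
      induction i using Fin.cases <;> rfl

/-- A square walk pattern between two edges which occurs on all transversals of a blow-up gives a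
genuine square path of the same length. -/
lemma exists_kpath_of_blowup {n m r : ℕ} {G : Fin n → Fin n → Prop} (hG : IsDigraph G)
    {a b y z : Fin n} (hab : G a b) (hyz : G y z) (hay : a ≠ y) (haz : a ≠ z) (hby : b ≠ y)
    (hbz : b ≠ z) (hr : 0 < r) {w : Fin m → Fin r → Fin n} (hw : Function.Injective2 w)
    (hwF : ∀ i k, w i k ∉ ({a, b, y, z} : Finset (Fin n))) {σ : List (Fin m)} (hσ : σ.length ≤ r)
    (h : ∀ j : Fin m → Fin r,
      IsSqWalk G (a :: b :: (σ.map (fun i => w i (j i)) ++ [y, z]))) :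
    ∃ Q : List (Fin n), Q.length = σ.length ∧ IsKPath 2 G (a :: b :: (Q ++ [y, z])) := by
  let τ : List (Fin m × Fin r) := List.ofFn fun k : Fin σ.length => (σ.get k, Fin.castLE hσ k)
  have hτfst : τ.map Prod.fst = σ := by
    simp only [τ, List.map_ofFn]
    exact List.ofFn_get σ
  have hτnodup : τ.Nodup := by
    rw [List.nodup_ofFn]
    intro k k' hk
    exact Fin.castLE_injective hσ (Prod.ext_iff.1 hk).2
  let E : List (Fin 4 ⊕ Fin m × Fin r) :=
    .inl 0 :: .inl 1 :: (τ.map Sum.inr ++ [.inl 2, .inl 3])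
  let val : Fin 4 ⊕ Fin m × Fin r → Fin n := Sum.elim ![a, b, y, z] fun e => w e.1 e.2
  have hEval : E.map val = a :: b :: (τ.map (fun e => w e.1 e.2) ++ [y, z]) := by
    simp [E, val, Function.comp_def]
  refine ⟨τ.map fun e => w e.1 e.2, by simp [τ], ?_⟩
  rw [← hEval]
  have hab' : a ≠ b := fun e => hG a (by rwa [← e] at hab)
  have hyz' : y ≠ z := fun e => hG y (by rwa [← e] at hyz)
  have hval : Function.Injective val := by
    refine Function.Injective.sumElim ?_ ?_ ?_
    · intro i i'
      fin_cases i <;> fin_cases i' <;> simp [hab', hyz', hay, haz, hby, hbz, hab'.symm,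
        hyz'.symm, hay.symm, haz.symm, hby.symm, hbz.symm]
    · intro e e' he
      exact Prod.ext (hw he).1 (hw he).2
    · intro i e he
      refine hwF e.1 e.2 ?_
      rw [← he]
      fin_cases i <;> simp
  have hE : E.Nodup := by
    have := hτnodup.map (f := Sum.inr (α := Fin 4)) Sum.inr_injective
    simp [E, List.nodup_append, this]
  have hwalk : IsSqWalk G (E.map val) := by
    refine IsSqWalk.lift (U := Fin m → Fin r) (I := Fin 4 ⊕ Fin m) (Sum.map id Prod.fst)
      (fun j => Sum.elim ![a, b, y, z] fun i => w i (j i)) val ?_ ?_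
    · rintro (i | ⟨i, k⟩) (i' | ⟨i', k'⟩) hadj
      · exact hadj fun _ => ⟨0, hr⟩
      · exact hadj fun _ => k'
      · exact hadj fun _ => k
      · by_cases hii : i = i'
        · subst hii
          exact (hG _ (hadj fun _ => k)).elim
        · have := hadj (Function.update (fun _ => k) i' k')
          simpa [hii, val] using this
    · intro j
      have := h j
      rw [← hτfst] at this
      simpa [E, Function.comp_def] using this
  exact ⟨hE.map hval, fun i j hij hij2 => hwalk.adj i j i.2 j.2 hij hij2⟩

section MinDegree

variable {n : ℕ} {γ : ℝ} {G : Fin n → Fin n → Prop}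

/-- Every vertex of `G` has total degree at least `(8/5 + γ) n`. -/
def LargeDeg (γ : ℝ) (G : Fin n → Fin n → Prop) : Prop :=
  ∀ v, (8 / 5 + γ) * n ≤ ((∑ w, arc G v w : ℕ) : ℝ) + ((∑ w, arc G w v : ℕ) : ℝ)

lemma LargeDeg.swap (h : LargeDeg γ G) : LargeDeg γ fun u v => G v u := fun v =>
  (h v).trans (add_comm _ _).le

lemma LargeDeg.out (h : LargeDeg γ G) (v : Fin n) :
    (3 / 5 + γ) * n ≤ ((∑ w, arc G v w : ℕ) : ℝ) := by
  have h1 : ∑ w, arc G w v ≤ n := by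
    refine (Finset.sum_le_sum fun w _ => arc_le_one G w v).trans ?_
    simp
  have h2 : ((∑ w, arc G w v : ℕ) : ℝ) ≤ n := by exact_mod_cast h1
  have := h v
  linarith

lemma LargeDeg.many_out (hγ : 0 < γ) (h : LargeDeg γ G) (a b : Fin n) :
    Many (γ / 10) fun c => G a c ∧ G b c := by
  have h1 := many_of_le_sum (γ := γ) 1 (fun c => arc G a c + arc G b c)
    (fun c => by have := arc_le_one G a c; have := arc_le_one G b c; omega) (by
      rw [Finset.sum_add_distrib]
      have := h.out a
      have := h.out b
      have : 0 ≤ γ * n := by positivity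
      have : (0 : ℝ) ≤ n := by positivity
      push_cast at *
      linarith)
  refine h1.mono fun c hc => ?_
  have := arc_le_one G a c
  have := arc_le_one G b c
  exact ⟨adj_of_arc (by omega), adj_of_arc (by omega)⟩

lemma LargeDeg.many_out_bi (hγ : 0 < γ) (h : LargeDeg γ G) (b c : Fin n) :
    Many (γ / 10) fun d => G b d ∧ Bi G c d := by
  have h1 := many_of_le_sum (γ := γ) 2 (fun d => arc G b d + (arc G c d + arc G d c))
    (fun d => by
      have := arc_le_one G b d; have := arc_le_one G c d; have := arc_le_one G d c; omega) (by
      simp only [Finset.sum_add_distrib]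
      have := h.out b
      have := h c
      have : 0 ≤ γ * n := by positivity
      have : (0 : ℝ) ≤ n := by positivity
      push_cast at *
      linarith)
  refine h1.mono fun d hd => ?_
  have := arc_le_one G b d
  have := arc_le_one G c d
  have := arc_le_one G d c
  exact ⟨adj_of_arc (by omega), adj_of_arc (by omega), adj_of_arc (by omega)⟩

lemma LargeDeg.many_bi_bi (hγ : 0 < γ) (h : LargeDeg γ G) (p o : Fin n) :
    Many (γ / 10) fun t => Bi G p t ∧ Bi G o t := by
  have h1 := many_of_le_sum (γ := γ) 3
    (fun t => arc G p t + arc G t p + (arc G o t + arc G t o))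
    (fun t => by
      have := arc_le_one G p t; have := arc_le_one G t p
      have := arc_le_one G o t; have := arc_le_one G t o; omega) (by
      simp only [Finset.sum_add_distrib]
      have := h p
      have := h o
      have : 0 ≤ γ * n := by positivity
      have : (0 : ℝ) ≤ n := by positivity
      push_cast at *
      linarith)
  refine h1.mono fun t ht => ?_
  have := arc_le_one G p t
  have := arc_le_one G t p
  have := arc_le_one G o t
  have := arc_le_one G t o
  exact ⟨⟨adj_of_arc (by omega), adj_of_arc (by omega)⟩, adj_of_arc (by omega),
    adj_of_arc (by omega)⟩

lemma LargeDeg.many_arcsTo (hγ : 0 < γ) (h : LargeDeg γ G) (p c d x t : Fin n) :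
    Many (γ / 10) fun q => 9 ≤ arcsTo G p c d x t q := by
  refine many_of_le_sum (γ := γ) 8 (arcsTo G p c d x t) (fun q => ?_) ?_
  · unfold arcsTo
    have := arc_le_one G p q
    have := arc_le_one G q p
    have := arc_le_one G c q
    have := arc_le_one G q c
    have := arc_le_one G d q
    have := arc_le_one G q d
    have := arc_le_one G x q
    have := arc_le_one G q x
    have := arc_le_one G t q
    have := arc_le_one G q t
    omega
  · simp only [arcsTo, Finset.sum_add_distrib]
    have := h p
    have := h c
    have := h d
    have := h x
    have := h t
    have : 0 ≤ γ * n := by positivity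
    push_cast at *
    linarith

/-- Many vertices are joined in both directions to all but at most one of `c, d, x, w`. -/
lemma LargeDeg.many_bi_three (hγ : 0 < γ) (h : LargeDeg γ G) (c d x w : Fin n) :
    Many (γ / 10) fun p => (Bi G c p ∧ Bi G d p ∧ (Bi G p x ∨ Bi G p w)) ∨
      (Bi G x p ∧ Bi G w p ∧ (Bi G p c ∨ Bi G p d)) := by
  have h1 := many_of_le_sum (γ := γ) 6
    (fun p => arc G c p + arc G p c + (arc G d p + arc G p d) + (arc G x p + arc G p x) +
      (arc G w p + arc G p w))
    (fun p => by
      have := arc_le_one G c p; have := arc_le_one G p c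
      have := arc_le_one G d p; have := arc_le_one G p d
      have := arc_le_one G x p; have := arc_le_one G p x
      have := arc_le_one G w p; have := arc_le_one G p w; omega) (by
      simp only [Finset.sum_add_distrib]
      have := h c
      have := h d
      have := h x
      have := h w
      have : 0 ≤ γ * n := by positivity
      have : (0 : ℝ) ≤ n := by positivity
      push_cast at *
      linarith)
  refine h1.mono fun p hp => ?_
  have hbi {u v : Fin n} (huv : 2 ≤ arc G u v + arc G v u) : Bi G u v := by
    have := arc_le_one G u v
    have := arc_le_one G v u
    exact ⟨adj_of_arc (by omega), adj_of_arc (by omega)⟩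
  have := arc_le_one G c p
  have := arc_le_one G p c
  have := arc_le_one G d p
  have := arc_le_one G p d
  have := arc_le_one G x p
  have := arc_le_one G p x
  have := arc_le_one G w p
  have := arc_le_one G p w
  have key : (2 ≤ arc G c p + arc G p c ∧ 2 ≤ arc G d p + arc G p d ∧
      (2 ≤ arc G p x + arc G x p ∨ 2 ≤ arc G p w + arc G w p)) ∨
      (2 ≤ arc G x p + arc G p x ∧ 2 ≤ arc G w p + arc G p w ∧
      (2 ≤ arc G p c + arc G c p ∨ 2 ≤ arc G p d + arc G d p)) := by omega
  exact key.imp (fun ⟨h1, h2, h3⟩ => ⟨hbi h1, hbi h2, h3.imp hbi hbi⟩)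
    fun ⟨h1, h2, h3⟩ => ⟨hbi h1, hbi h2, h3.imp hbi hbi⟩

/-- Connecting bidirected edges `cd` and `xw`, where a vertex `p` forms a bidirected triangle with
`cd` and is joined in both directions to `x` or `w`. -/
lemma LargeDeg.many_walks (hγ : 0 < γ) (h : LargeDeg γ G) {c d x w p : Fin n} (hcd : Bi G c d)
    (hxw : Bi G x w) (hcp : Bi G c p) (hdp : Bi G d p) (hp : Bi G p x ∨ Bi G p w) :
    Many (γ / 10) fun t => Many (γ / 10) fun s => Many (γ / 10) fun q => Many (γ / 10) fun q' =>
      ∃ L : List (Fin n), L.length ≤ 12 ∧ (∀ v ∈ L, v ∈ [c, d, x, w, p, t, s, q, q']) ∧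
        IsSqWalk G (c :: d :: (L ++ [x, w])) := by
  obtain ⟨o, r, hor, hpo⟩ : ∃ o r, ((o = x ∧ r = w) ∨ (o = w ∧ r = x)) ∧ Bi G p o := by
    rcases hp with hp | hp
    · exact ⟨x, w, Or.inl ⟨rfl, rfl⟩, hp⟩
    · exact ⟨w, x, Or.inr ⟨rfl, rfl⟩, hp⟩
  refine (h.many_bi_bi hγ p o).mono fun t ht => ?_
  refine (h.many_bi_bi hγ o r).mono fun s hs => ?_
  refine (h.many_arcsTo hγ p c d o t).mono fun q hq => ?_
  refine (h.many_arcsTo hγ o t p r s).mono fun q' hqs => ?_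
  exact exists_walk_of_bowties hor hcd hcp hdp hpo hxw ht.1 ht.2 hs.1 hs.2 hq hqs

/-- Densely many `9`-tuples support a square walk on at most `20` entries from `ab` to `yz`. -/
lemma LargeDeg.rich_walks (hγ : 0 < γ) (h : LargeDeg γ G) {a b y z : Fin n} (hab : G a b)
    (hyz : G y z) :
    Rich (γ / 10) 9 fun u => ∃ Q : List (Fin n), Q.length ≤ 16 ∧ (∀ v ∈ Q, v ∈ Set.range u) ∧
      IsSqWalk G (a :: b :: (Q ++ [y, z])) := by
  refine (h.many_out hγ a b).mono fun c ⟨hac, hbc⟩ => ?_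
  refine (h.many_out_bi hγ b c).mono fun d ⟨hbd, hcd⟩ => ?_
  refine (h.swap.many_out hγ y z).mono fun w ⟨hwy, hwz⟩ => ?_
  refine (h.swap.many_out_bi hγ y w).mono fun x ⟨hxy, hxw⟩ => ?_
  replace hxw : Bi G x w := hxw
  refine (h.many_bi_three hγ c d x w).mono fun p hp => ?_
  have hmany : Many (γ / 10) fun t => Many (γ / 10) fun s => Many (γ / 10) fun q =>
      Many (γ / 10) fun q' => ∃ L : List (Fin n), L.length ≤ 12 ∧
        (∀ v ∈ L, v ∈ [c, d, w, x, p, t, s, q, q']) ∧ IsSqWalk G (c :: d :: (L ++ [x, w])) := by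
    rcases hp with ⟨hcp, hdp, hp⟩ | ⟨hxp, hwp, hp⟩
    · refine (h.many_walks hγ hcd hxw hcp hdp hp).mono fun t ht => ht.mono fun s hs =>
        hs.mono fun q hq => hq.mono fun q' ⟨L, hL, hm, hw⟩ => ⟨L, hL, fun v hv => ?_, hw⟩
      have := hm v hv
      simp only [List.mem_cons, List.not_mem_nil, or_false] at this ⊢
      grind
    · refine (h.swap.many_walks hγ (c := w) (d := x) (x := d) (w := c) (p := p) hxw hcd hwp.symm
        hxp.symm (hp.symm.imp Bi.symm Bi.symm)).mono fun t ht => ht.mono fun s hs =>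
        hs.mono fun q hq => hq.mono fun q' ⟨L, hL, hm, hw⟩ =>
          ⟨L.reverse, by simpa using hL, fun v hv => ?_, by simpa using hw.reverse⟩
      have := hm v (by simpa using hv)
      simp only [List.mem_cons, List.not_mem_nil, or_false] at this ⊢
      grind
  refine hmany.mono fun t ht => ht.mono fun s hs => hs.mono fun q hq => hq.mono
    fun q' ⟨L, hL, hm, hw⟩ => ?_
  refine ⟨c :: d :: (L ++ [x, w]), by simp; omega, fun v hv => ?_, ?_⟩
  · have hv' : v ∈ [c, d, w, x, p, t, s, q, q'] := by
      have := hm v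
      simp only [List.mem_cons, List.mem_append, List.not_mem_nil, or_false] at this hv ⊢
      grind
    simp only [List.mem_cons, List.not_mem_nil, or_false] at hv'
    rcases hv' with e | e | e | e | e | e | e | e | e
    · exact ⟨0, e.symm⟩
    · exact ⟨1, e.symm⟩
    · exact ⟨2, e.symm⟩
    · exact ⟨3, e.symm⟩
    · exact ⟨4, e.symm⟩
    · exact ⟨5, e.symm⟩
    · exact ⟨6, e.symm⟩
    · exact ⟨7, e.symm⟩
    · exact ⟨8, e.symm⟩
  · have h1 : IsSqWalk G (c :: d :: (L ++ [x, w, y, z])) := by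
      have := IsSqWalk.glue (A := c :: d :: L) (B := [y, z]) hw ⟨hxw.1, hxy, hwy, hwz, hyz⟩
      simpa using this
    have h2 : IsSqWalk G (a :: b :: c :: d :: (L ++ [x, w, y, z])) := ⟨hab, hac, hbc, hbd, h1⟩
    simpa only [List.cons_append, List.append_assoc, List.nil_append] using h2

end MinDegree

lemma sum_arc_out {n : ℕ} (G : Fin n → Fin n → Prop) (v : Fin n) :
    ∑ w, arc G v w = outDeg G v := by
  classical
  simp [arc, outDeg, Set.ncard_eq_toFinset_card']

lemma sum_arc_in {n : ℕ} (G : Fin n → Fin n → Prop) (v : Fin n) :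
    ∑ w, arc G w v = inDeg G v :=
  sum_arc_out (fun u w => G w u) v

/-- Connecting lemma: for every `0 < γ < 1` there is `n₀` such that in every digraph on
`n ≥ n₀` vertices with minimum total degree at least `(8/5 + γ)n`, any two vertex-disjoint
edges `ab` and `yz` are joined by a `2`-path on at most `20` vertices starting with `a, b`
and ending with `y, z`. -/
theorem statement_9 (γ : ℝ) (hγ0 : 0 < γ) (hγ1 : γ < 1) :
    ∃ n₀ : ℕ, ∀ n : ℕ, n₀ ≤ n → ∀ G : Fin n → Fin n → Prop, IsDigraph G →
      (∀ v, (8/5 + γ) * n ≤ ((outDeg G v + inDeg G v : ℕ) : ℝ)) →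
      ∀ a b y z : Fin n, G a b → G y z → a ≠ y → a ≠ z → b ≠ y → b ≠ z →
        ∃ Q : List (Fin n),
          IsKPath 2 G (a :: b :: (Q ++ [y, z])) ∧
          (a :: b :: (Q ++ [y, z])).length ≤ 20 := by
  classical
  let W : Finset (List (Fin 9)) := (List.finite_length_le (Fin 9) 16).toFinset
  have hW : W.Nonempty := ⟨[], by simp [W]⟩
  have hWpos : (0 : ℝ) < W.card := by exact_mod_cast hW.card_pos
  have hε : 0 < (γ / 10) ^ 9 / W.card := by positivity
  obtain ⟨N, hN⟩ := exists_blowup 16 9 4 hε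
  refine ⟨N, fun n hn G hG hdeg a b y z hab hyz hay haz hby hbz => ?_⟩
  have hL : LargeDeg γ G := fun v => by
    rw [sum_arc_out, sum_arc_in]
    exact_mod_cast hdeg v
  have hcount := (hL.rich_walks hγ0 hab hyz).le_ncard (by positivity)
  -- one pattern of repetitions accounts for a positive proportion of the tuples
  set P : Set (Fin 9 → Fin n) := {u | ∃ Q : List (Fin n), Q.length ≤ 16 ∧
    (∀ v ∈ Q, v ∈ Set.range u) ∧ IsSqWalk G (a :: b :: (Q ++ [y, z]))}
  have hpat (u : Fin 9 → Fin n) : ∃ σ : List (Fin 9),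
      u ∈ P → σ ∈ W ∧ IsSqWalk G (a :: b :: (σ.map u ++ [y, z])) := by
    by_cases hQ : u ∈ P
    · obtain ⟨Q, h1, h2, h3⟩ := hQ
      obtain ⟨σ, rfl⟩ : Q ∈ Set.range (List.map u) := by rwa [Set.range_list_map]
      exact ⟨σ, fun _ => ⟨by simpa [W] using h1, h3⟩⟩
    · exact ⟨[], fun h => (hQ h).elim⟩
  choose σ hσ using hpat
  rw [Set.ncard_eq_toFinset_card'] at hcount
  obtain ⟨σ₀, hσ₀, hσ₀card⟩ := Finset.exists_le_card_fiber_of_nsmul_le_card_of_maps_to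
    (s := P.toFinset) (t := W) (f := σ) (b := (γ / 10) ^ 9 / W.card * (n : ℝ) ^ 9)
    (fun u hu => (hσ u (Set.mem_toFinset.1 hu)).1) hW (by
      rw [nsmul_eq_mul]
      refine le_trans (le_of_eq ?_) hcount
      field_simp)
  obtain ⟨w, hw, hwF, hwP⟩ := hN n hn {a, b, y, z} Finset.card_le_four
    (fun u => IsSqWalk G (a :: b :: (σ₀.map u ++ [y, z]))) (by
      refine hσ₀card.trans ?_
      rw [← Set.ncard_coe_finset, Nat.cast_le]
      refine Set.ncard_le_ncard (fun u hu => ?_) (Set.toFinite _)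
      obtain ⟨huP, rfl⟩ := Finset.mem_filter.1 (Finset.mem_coe.1 hu)
      exact (hσ u (Set.mem_toFinset.1 huP)).2)
  have hlen : σ₀.length ≤ 16 := by simpa [W] using hσ₀
  obtain ⟨Q, hQ, hpath⟩ := exists_kpath_of_blowup hG hab hyz hay haz hby hbz (by norm_num) hw hwF
    hlen hwP
  exact ⟨Q, hpath, by simp; omega⟩

end Paper
end

section
/- Let k ≥ 2. There exists n₀ ∈ ℕ such that the following holds for every n ≥ n₀: if G is an n-vertex oriented graph with minimum semi-degree δ⁰(G) = δn > (k−1)n/(2k−1), then every tournament T on 2k−1 vertices contained in G contains both a δ-out-good tournament on k vertices and a δ-in-good tournament on k vertices. -/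
namespace Paper

/-- A `k`-vertex set `S` is `δ`-out-good in the `n`-vertex graph `G` if the common
out-neighbourhood of `S` has at least `((2k-1)δ - k + 1)n/(k·2^(2k-1))` vertices. -/
def OutGood {n : ℕ} (G : Fin n → Fin n → Prop) (k : ℕ) (δ : ℝ) (S : Finset (Fin n)) : Prop :=
  ((2*(k:ℝ) - 1) * δ - (k:ℝ) + 1) * n / ((k:ℝ) * 2^(2*k - 1)) ≤
    (({w | ∀ x ∈ S, G x w} : Set (Fin n)).ncard : ℝ)

/-- A `k`-vertex set `S` is `δ`-in-good in the `n`-vertex graph `G` if the common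
in-neighbourhood of `S` has at least `((2k-1)δ - k + 1)n/(k·2^(2k-1))` vertices. -/
def InGood {n : ℕ} (G : Fin n → Fin n → Prop) (k : ℕ) (δ : ℝ) (S : Finset (Fin n)) : Prop :=
  ((2*(k:ℝ) - 1) * δ - (k:ℝ) + 1) * n / ((k:ℝ) * 2^(2*k - 1)) ≤
    (({w | ∀ x ∈ S, G w x} : Set (Fin n)).ncard : ℝ)

open Finset in
/-- If every vertex of a `(2k-1)`-set `T` has at least `δn` `R`-successors, then some `k`-subset
of `T` has many common `R`-successors. The relation `R` is arbitrary. -/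
lemma exists_subset_outGood {n k : ℕ} (hk : 1 ≤ k) (R : Fin n → Fin n → Prop) (δ : ℝ)
    (hR : ∀ v, δ * n ≤ (({w | R v w} : Set (Fin n)).ncard : ℝ))
    (T : Finset (Fin n)) (hT : #T = 2 * k - 1) :
    ∃ S ⊆ T, #S = k ∧ OutGood R k δ S := by
  classical
  let A : Finset (Fin n) := {w | k ≤ #{x ∈ T | R x w}}
  have hkR : (1 : ℝ) ≤ k := by exact_mod_cast hk
  have hTR : (#T : ℝ) = 2 * k - 1 := by
    rw [hT, Nat.cast_sub (by omega)]
    push_cast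
    ring
  have double_count : ∑ v ∈ T, #{w | R v w} = ∑ w, #{x ∈ T | R x w} :=
    sum_card_bipartiteAbove_eq_sum_card_bipartiteBelow R
  have lower : (2 * (k : ℝ) - 1) * (δ * n) ≤ ((∑ v ∈ T, #{w | R v w} : ℕ) : ℝ) := by
    rw [← hTR, ← nsmul_eq_mul]
    push_cast
    refine card_nsmul_le_sum _ _ _ fun v _ => ?_
    simpa [Set.ncard_eq_toFinset_card'] using hR v
  have upper : ∑ w, #{x ∈ T | R x w} ≤ n * (k - 1) + #A * k := by
    calc ∑ w, #{x ∈ T | R x w} ≤ ∑ w, ((k - 1) + if k ≤ #{x ∈ T | R x w} then k else 0) := by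
          refine sum_le_sum fun w _ => ?_
          have := card_filter_le T (R · w)
          split_ifs <;> omega
      _ = n * (k - 1) + #A * k := by
          simp [sum_add_distrib, ← sum_filter, A]
  have hA : ((2 * (k : ℝ) - 1) * δ - k + 1) * n ≤ #A * k := by
    have h : ((∑ w, #{x ∈ T | R x w} : ℕ) : ℝ) ≤ ((n * (k - 1) + #A * k : ℕ) : ℝ) := by
      exact_mod_cast upper
    rw [← double_count] at h
    push_cast [Nat.cast_sub hk] at h lower
    linarith
  have hsub : ∀ w, ∃ S, w ∈ A → S ⊆ {x ∈ T | R x w} ∧ #S = k := fun w => by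
    by_cases hw : w ∈ A
    · obtain ⟨S, hS⟩ := exists_subset_card_eq (mem_filter.1 hw).2
      exact ⟨S, fun _ => hS⟩
    · exact ⟨∅, fun h => absurd h hw⟩
  choose f hf using hsub
  have hmaps : ∀ w ∈ A, f w ∈ powersetCard k T := fun w hw =>
    mem_powersetCard.2 ⟨(hf w hw).1.trans (filter_subset _ _), (hf w hw).2⟩
  have hcard : #(powersetCard k T) ≤ 2 ^ (2 * k - 1) := by
    rw [card_powersetCard, hT]
    exact Nat.choose_le_two_pow _ _
  obtain ⟨S, hS, hfiber⟩ := exists_le_card_fiber_of_nsmul_le_card_of_maps_to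
    (b := (#A : ℝ) / 2 ^ (2 * k - 1)) hmaps (powersetCard_nonempty.2 (by omega)) (by
      have : (#(powersetCard k T) : ℝ) ≤ 2 ^ (2 * k - 1) := by exact_mod_cast hcard
      rw [nsmul_eq_mul, mul_div_assoc', div_le_iff₀ (by positivity), mul_comm]
      gcongr)
  rw [mem_powersetCard] at hS
  refine ⟨S, hS.1, hS.2, ?_⟩
  unfold OutGood
  calc ((2 * (k : ℝ) - 1) * δ - k + 1) * n / (k * 2 ^ (2 * k - 1))
      ≤ #A * k / (k * 2 ^ (2 * k - 1)) := by gcongr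
    _ = #A / 2 ^ (2 * k - 1) := by field_simp
    _ ≤ #{w ∈ A | f w = S} := hfiber
    _ ≤ (({w | ∀ x ∈ S, R x w} : Set (Fin n)).ncard : ℝ) := by
      rw [← Set.ncard_coe_finset]
      refine Nat.cast_le.2 (Set.ncard_le_ncard (fun w hw x hx => ?_) (Set.toFinite _))
      obtain ⟨hwA, rfl⟩ := mem_filter.1 (mem_coe.1 hw)
      exact (mem_filter.1 ((hf w hwA).1 hx)).2

/-- For `k ≥ 2` and sufficiently large oriented graphs `G` with minimum semi-degree exactly
`δn > (k-1)n/(2k-1)`, every tournament on `2k-1` vertices in `G` contains a `δ`-out-good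
tournament on `k` vertices and a `δ`-in-good tournament on `k` vertices. -/
theorem statement_11 (k : ℕ) (hk : 2 ≤ k) :
    ∃ n₀ : ℕ, ∀ n : ℕ, n₀ ≤ n → ∀ G : Fin n → Fin n → Prop, IsOriented G →
      ∀ δ : ℝ,
        (∀ v, δ * n ≤ ((min (outDeg G v) (inDeg G v) : ℕ) : ℝ)) →
        (∃ v, ((min (outDeg G v) (inDeg G v) : ℕ) : ℝ) = δ * n) →
        ((k:ℝ) - 1) * n / (2*(k:ℝ) - 1) < δ * n →
        ∀ T : Finset (Fin n), T.card = 2*k - 1 →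
          (∀ x ∈ T, ∀ y ∈ T, x ≠ y → G x y ∨ G y x) →
          (∃ S ⊆ T, S.card = k ∧ OutGood G k δ S) ∧
          (∃ S ⊆ T, S.card = k ∧ InGood G k δ S) := by
  refine ⟨0, fun n _ G _ δ hδ _ _ T hT _ => ⟨?_, ?_⟩⟩
  · refine exists_subset_outGood (by omega) G δ (fun v => (hδ v).trans ?_) T hT
    exact Nat.cast_le.2 (min_le_left _ _)
  · refine exists_subset_outGood (by omega) (fun x w => G w x) δ (fun v => (hδ v).trans ?_) T hT
    exact Nat.cast_le.2 (min_le_right _ _)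

end Paper
end

section
/- Let G be an n-vertex oriented graph with minimum semi-degree δ⁰(G) ≥ δn ≥ 2n/5. Then for any disjoint sets A, B ⊆ V(G), the number e(A,B) of edges directed from A to B satisfies e(A,B) ≥ |A|(|A|/2 + |B| − (1−δ)n). In particular, if |A| ≥ |B| ≥ δn, then e(A,B) ≥ (5/2 − 1/δ)|A||B|. -/
namespace Paper

/-- In an oriented graph, at most `|S|² / 2` edges lie inside a vertex set `S`. -/
lemma IsOriented.two_mul_sum_card_le {n : ℕ} {G : Fin n → Fin n → Prop} [DecidableRel G]
    (hG : IsOriented G) (S : Finset (Fin n)) :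
    2 * ∑ x ∈ S, (S.filter (G x)).card ≤ S.card * S.card := by
  have hswap : ∑ x ∈ S, (S.filter (G x)).card = ∑ x ∈ S, (S.filter fun y => G y x).card := by
    simp only [Finset.card_filter]
    exact Finset.sum_comm
  have hle : ∀ x ∈ S, (S.filter (G x)).card + (S.filter fun y => G y x).card ≤ S.card := by
    intro x _
    rw [← Finset.card_union_of_disjoint]
    · exact Finset.card_le_card
        (Finset.union_subset (Finset.filter_subset _ _) (Finset.filter_subset _ _))
    · exact Finset.disjoint_filter.2 fun y _ => hG x y
  calc 2 * ∑ x ∈ S, (S.filter (G x)).card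
      = ∑ x ∈ S, ((S.filter (G x)).card + (S.filter fun y => G y x).card) := by
        rw [Finset.sum_add_distrib, ← hswap, two_mul]
    _ ≤ ∑ _x ∈ S, S.card := Finset.sum_le_sum hle
    _ = S.card * S.card := by simp

/-- Out-neighbours of `v` lie in `S`, in `T`, or among the vertices outside `S ∪ T`. -/
lemma outDeg_add_card_le {n : ℕ} (G : Fin n → Fin n → Prop) [DecidableRel G]
    {S T : Finset (Fin n)} (hST : Disjoint S T) (v : Fin n) :
    outDeg G v + S.card + T.card ≤ n + (S.filter (G v)).card + (T.filter (G v)).card := by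
  have hout : outDeg G v = (Finset.univ.filter (G v)).card := by
    rw [outDeg, ← Set.ncard_coe_finset]
    simp
  have hsub : Finset.univ.filter (G v) ⊆
      S.filter (G v) ∪ T.filter (G v) ∪ (S ∪ T)ᶜ := by
    intro w hw
    simp only [Finset.mem_filter, Finset.mem_univ, true_and] at hw
    simp only [Finset.mem_union, Finset.mem_filter, Finset.mem_compl, hw, and_true]
    tauto
  have hcard := Finset.card_le_card hsub
  have h₁ := Finset.card_union_le (S.filter (G v) ∪ T.filter (G v)) (S ∪ T)ᶜ
  have h₂ := Finset.card_union_le (S.filter (G v)) (T.filter (G v))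
  have h₃ := Finset.card_add_card_compl (S ∪ T)
  rw [Finset.card_union_of_disjoint hST, Fintype.card_fin] at h₃
  omega

/-- The number of edges from `S` to `T` as a sum of degrees into `T`. -/
lemma ncard_edges_eq_sum {n : ℕ} (G : Fin n → Fin n → Prop) [DecidableRel G]
    (S T : Finset (Fin n)) :
    {p : Fin n × Fin n | p.1 ∈ (S : Set (Fin n)) ∧ p.2 ∈ (T : Set (Fin n)) ∧ G p.1 p.2}.ncard =
      ∑ x ∈ S, (T.filter (G x)).card := by
  rw [← Finset.card_sigma, ← Set.ncard_coe_finset]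
  refine Set.ncard_congr (fun p _ => ⟨p.1, p.2⟩) ?_ ?_ ?_
  · rintro ⟨x, y⟩ h
    simpa using h
  · rintro ⟨x, y⟩ ⟨x', y'⟩ _ _ h
    simpa using h
  · rintro ⟨x, y⟩ h
    exact ⟨(x, y), by simpa using h, rfl⟩

/-- Lower bound on the number of edges between disjoint sets, from the minimum out-degree. -/
lemma IsOriented.card_mul_le_ncard_edges {n : ℕ} {G : Fin n → Fin n → Prop}
    (hG : IsOriented G) {d : ℝ} (hd : ∀ v, d ≤ outDeg G v) {A B : Set (Fin n)}
    (hAB : Disjoint A B) :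
    (A.ncard : ℝ) * (A.ncard / 2 + B.ncard - (n - d)) ≤
      ({p : Fin n × Fin n | p.1 ∈ A ∧ p.2 ∈ B ∧ G p.1 p.2}.ncard : ℝ) := by
  classical
  lift A to Finset (Fin n) using A.toFinite
  lift B to Finset (Fin n) using B.toFinite
  rw [Finset.disjoint_coe] at hAB
  rw [ncard_edges_eq_sum, Set.ncard_coe_finset, Set.ncard_coe_finset]
  have hinside : (2 : ℝ) * ∑ x ∈ A, ((A.filter (G x)).card : ℝ) ≤ A.card * A.card := by
    exact_mod_cast hG.two_mul_sum_card_le A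
  have hsum : ∑ _x ∈ A, (d + A.card + B.card - n) ≤
      ∑ x ∈ A, (((A.filter (G x)).card : ℝ) + (B.filter (G x)).card) := by
    refine Finset.sum_le_sum fun x _ => ?_
    have hdeg : (outDeg G x : ℝ) + A.card + B.card ≤
        n + (A.filter (G x)).card + (B.filter (G x)).card := by
      exact_mod_cast outDeg_add_card_le G hAB x
    linarith [hd x]
  rw [Finset.sum_const, nsmul_eq_mul, Finset.sum_add_distrib] at hsum
  push_cast
  linarith

/-- Crossing edges between large sets: if `G` is an `n`-vertex oriented graph with minimum
semi-degree at least `δn ≥ 2n/5`, then for any disjoint `A, B ⊆ V(G)` the number of edges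
from `A` to `B` is at least `|A|(|A|/2 + |B| - (1-δ)n)`; moreover, if `|A| ≥ |B| ≥ δn`
then it is at least `(5/2 - 1/δ)|A||B|`. -/
theorem statement_12 (n : ℕ) (G : Fin n → Fin n → Prop) (hG : IsOriented G) (δ : ℝ)
    (hδ : 2 * (n:ℝ) / 5 ≤ δ * n)
    (hmin : ∀ v, δ * n ≤ ((min (outDeg G v) (inDeg G v) : ℕ) : ℝ))
    (A B : Set (Fin n)) (hAB : Disjoint A B) :
    ((A.ncard : ℝ) * ((A.ncard : ℝ)/2 + (B.ncard : ℝ) - (1 - δ) * n) ≤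
      (({p : Fin n × Fin n | p.1 ∈ A ∧ p.2 ∈ B ∧ G p.1 p.2}).ncard : ℝ)) ∧
    (B.ncard ≤ A.ncard → δ * n ≤ (B.ncard : ℝ) →
      (5/2 - 1/δ) * (A.ncard : ℝ) * (B.ncard : ℝ) ≤
        (({p : Fin n × Fin n | p.1 ∈ A ∧ p.2 ∈ B ∧ G p.1 p.2}).ncard : ℝ)) := by
  have hedges := hG.card_mul_le_ncard_edges
    (fun v => (hmin v).trans (Nat.cast_le.2 (min_le_left _ _))) hAB
  rw [show (n : ℝ) - δ * n = (1 - δ) * n by ring] at hedges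
  refine ⟨hedges, fun hBA hB => le_trans ?_ hedges⟩
  rcases Nat.eq_zero_or_pos n with rfl | hn
  · simp [Set.eq_empty_of_isEmpty]
  have hn' : (0 : ℝ) < n := by exact_mod_cast hn
  have hδ0 : 0 < δ := by nlinarith
  have hBn : (B.ncard : ℝ) ≤ n := by
    exact_mod_cast (Set.ncard_le_card B).trans_eq (Nat.card_fin n)
  have hδ1 : δ ≤ 1 := by nlinarith
  have hBA' : (B.ncard : ℝ) ≤ A.ncard := by exact_mod_cast hBA
  have hdiv : (n : ℝ) ≤ B.ncard / δ := by rwa [le_div_iff₀ hδ0, mul_comm]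
  have hgap : (1 - δ) * n ≤ B.ncard / δ - B.ncard :=
    calc (1 - δ) * n ≤ (1 - δ) * (B.ncard / δ) :=
          mul_le_mul_of_nonneg_left hdiv (sub_nonneg.2 hδ1)
      _ = B.ncard / δ - B.ncard := by field_simp
  calc (5 / 2 - 1 / δ) * (A.ncard : ℝ) * B.ncard
      = A.ncard * (5 / 2 * B.ncard - B.ncard / δ) := by ring
    _ ≤ A.ncard * (A.ncard / 2 + B.ncard - (1 - δ) * n) :=
        mul_le_mul_of_nonneg_left (by linarith) (Nat.cast_nonneg _)

end Paper
end

section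
/- Let k ∈ ℕ, 0 < d ≤ 1, and set c := d^k/2^{1/k}. Let G = (A, B) be a bipartite graph with e(G) ≥ d|A||B|. Then for every 0 < ε < 1 there exists U ⊆ A with |U| ≥ c|A| such that all but at most (ε|U|)^k of the k-tuples of vertices in U have at least εc|B| common neighbors in B. -/
namespace Paper

open Finset in
/-- Double counting: sampling `k` elements of `B`, the sum of the number of common
`R`-neighbours in `S` is the sum of the `k`-th powers of the degrees. -/
lemma sum_card_commonNeighbors {γ β : Type*} (k : ℕ) (S : Finset γ) (B : Finset β)
    (R : γ → β → Prop) [∀ x, DecidablePred (R x)]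
    [∀ T : Fin k → β, DecidablePred fun x => ∀ j, R x (T j)] :
    ∑ T ∈ Fintype.piFinset (fun _ : Fin k => B), #{x ∈ S | ∀ j, R x (T j)} =
      ∑ x ∈ S, #{b ∈ B | R x b} ^ k := by
  classical
  have h := sum_card_bipartiteAbove_eq_sum_card_bipartiteBelow
    (s := Fintype.piFinset (fun _ : Fin k => B)) (t := S) (fun T x => ∀ j, R x (T j))
  simp only [bipartiteAbove, bipartiteBelow] at h
  convert h using 2 with x hx
  have h' : {T ∈ Fintype.piFinset (fun _ : Fin k => B) | ∀ j, R x (T j)} =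
      Fintype.piFinset (fun _ : Fin k => {b ∈ B | R x b}) := by
    ext T
    simp [forall_and]
  rw [h', Fintype.card_piFinset]
  simp

open Finset in
/-- The power mean inequality for a lower bound on the mean. -/
lemma pow_mul_card_le_sum_pow {ι : Type*} {k : ℕ} (hk : 1 ≤ k) (s : Finset ι) (f : ι → ℝ)
    (hf : ∀ i ∈ s, 0 ≤ f i) {m : ℝ} (hm : 0 ≤ m) (h : m * #s ≤ ∑ i ∈ s, f i) :
    m ^ k * #s ≤ ∑ i ∈ s, f i ^ k := by
  obtain ⟨k, rfl⟩ := Nat.exists_eq_add_of_le' hk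
  rcases s.eq_empty_or_nonempty with rfl | hs
  · simp
  have hs' : (0 : ℝ) < #s := by exact_mod_cast hs.card_pos
  calc m ^ (k + 1) * #s = (m * #s) ^ (k + 1) / (#s : ℝ) ^ k := by
        field_simp
        ring
    _ ≤ (∑ i ∈ s, f i) ^ (k + 1) / (#s : ℝ) ^ k := by gcongr
    _ ≤ _ := pow_sum_div_card_le_sum_pow hf k

open Finset in
/-- Dependent random choice, in the form where a single inequality controls both the size of
`U` and its number of bad tuples. -/
lemma exists_pow_add_card_bad_le {α β : Type*} {k : ℕ} (hk : 1 ≤ k) {d c ε : ℝ} (hd : 0 ≤ d)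
    (hc : 0 ≤ c) (hck : 2 * c ^ k = (d ^ k) ^ k) (hε : 0 ≤ ε) (A : Finset α) (B : Finset β)
    (hB : B.Nonempty) (E : α → β → Prop) [∀ a, DecidablePred (E a)]
    (he : d * #B * #A ≤ ∑ a ∈ A, (#{b ∈ B | E a b} : ℝ)) :
    ∃ U ⊆ A, (ε * (c * #A)) ^ k + (#{f ∈ Fintype.piFinset (fun _ : Fin k => U) |
      (#{b ∈ B | ∀ i, E (f i) b} : ℝ) < ε * c * #B} : ℝ) ≤ (ε * #U) ^ k := by
  classical
  set P := Fintype.piFinset (fun _ : Fin k => B)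
  have hPcard : (#P : ℝ) = (#B : ℝ) ^ k := by simp [P, Fintype.card_piFinset]
  set N : (Fin k → β) → Finset α := fun T => {a ∈ A | ∀ j, E a (T j)}
  set bad : Finset (Fin k → α) := {f ∈ Fintype.piFinset (fun _ : Fin k => A) |
      (#{b ∈ B | ∀ i, E (f i) b} : ℝ) < ε * c * #B}
  have hN : (d ^ k * #A) * #P ≤ ∑ T ∈ P, (#(N T) : ℝ) := by
    have h := pow_mul_card_le_sum_pow hk A (fun a => (#{b ∈ B | E a b} : ℝ))
      (fun _ _ => by positivity) (by positivity) he
    have h' : ∑ T ∈ P, (#(N T) : ℝ) = ∑ a ∈ A, (#{b ∈ B | E a b} : ℝ) ^ k := by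
      exact_mod_cast sum_card_commonNeighbors k A B E
    rw [h', hPcard]
    calc _ = (d * #B) ^ k * #A := by ring
      _ ≤ _ := h
  have hNk := pow_mul_card_le_sum_pow hk P (fun T => (#(N T) : ℝ))
      (fun _ _ => by positivity) (by positivity) hN
  have hbad : ∑ T ∈ P, (#{f ∈ bad | ∀ j, ∀ i, E (f i) (T j)} : ℝ) ≤
      (#A : ℝ) ^ k * (ε * c * #B) ^ k := by
    have h' : ∑ T ∈ P, (#{f ∈ bad | ∀ j, ∀ i, E (f i) (T j)} : ℝ) =
        ∑ f ∈ bad, (#{b ∈ B | ∀ i, E (f i) b} : ℝ) ^ k := by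
      exact_mod_cast sum_card_commonNeighbors k bad B (fun f b => ∀ i, E (f i) b)
    have hcard : (#bad : ℝ) ≤ (#A : ℝ) ^ k := by
      have := card_filter_le (Fintype.piFinset (fun _ : Fin k => A))
        (fun f => (#{b ∈ B | ∀ i, E (f i) b} : ℝ) < ε * c * #B)
      rw [Fintype.card_piFinset] at this
      simp only [prod_const, card_univ, Fintype.card_fin] at this
      exact_mod_cast this
    rw [h']
    calc _ ≤ ∑ f ∈ bad, (ε * c * #B) ^ k := by
          refine sum_le_sum fun f hf => ?_
          have := (mem_filter.mp hf).2
          gcongr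
      _ = #bad * (ε * c * #B) ^ k := by simp
      _ ≤ _ := by gcongr
  have hsum : ∑ T ∈ P, ((ε * (c * #A)) ^ k + (#{f ∈ bad | ∀ j, ∀ i, E (f i) (T j)} : ℝ)) ≤
      ∑ T ∈ P, (ε * #(N T)) ^ k := by
    simp only [sum_add_distrib, sum_const, nsmul_eq_mul, mul_pow ε, ← mul_sum]
    calc _ ≤ #P * (ε ^ k * (c * #A) ^ k) + (#A : ℝ) ^ k * (ε * c * #B) ^ k := by
            gcongr
      _ = ε ^ k * ((2 * c ^ k) * #A ^ k * #P) := by rw [hPcard]; ring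
      _ = ε ^ k * ((d ^ k * #A) ^ k * #P) := by rw [hck]; ring
      _ ≤ _ := by gcongr
  obtain ⟨T, -, hT⟩ := exists_le_of_sum_le (Fintype.piFinset_nonempty.2 fun _ => hB) hsum
  refine ⟨N T, filter_subset _ _, le_trans ?_ hT⟩
  gcongr
  intro f hf
  simp only [N, bad, mem_filter, Fintype.mem_piFinset] at hf ⊢
  exact ⟨⟨fun i => (hf.1 i).1, hf.2⟩, fun j i => (hf.1 i).2 j⟩

/-- Dependent random choice: let `k ∈ ℕ`, `0 < d ≤ 1` and `c = d^k/2^(1/k)`. If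
`G = (A, B)` is a bipartite graph with at least `d|A||B|` edges, then for every
`0 < ε < 1` there is `U ⊆ A` with `|U| ≥ c|A|` such that all but at most `(ε|U|)^k` of
the `k`-tuples of vertices of `U` have at least `εc|B|` common neighbours in `B`. -/
theorem statement_14 {α β : Type*} (k : ℕ) (hk : 1 ≤ k) (d : ℝ) (hd0 : 0 < d)
    (hd1 : d ≤ 1) (E : α → β → Prop) (A : Finset α) (B : Finset β) (c : ℝ)
    (hc : c = d^k / (2:ℝ)^((1:ℝ)/(k:ℝ)))
    (he : d * (A.card : ℝ) * (B.card : ℝ) ≤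
      (({p : α × β | p.1 ∈ A ∧ p.2 ∈ B ∧ E p.1 p.2}).ncard : ℝ))
    (ε : ℝ) (hε0 : 0 < ε) (hε1 : ε < 1) :
    ∃ U : Finset α, U ⊆ A ∧ c * (A.card : ℝ) ≤ (U.card : ℝ) ∧
      (({f : Fin k → α | (∀ i, f i ∈ U) ∧
          ((({b | b ∈ B ∧ ∀ i, E (f i) b} : Set β)).ncard : ℝ) < ε * c * (B.card : ℝ)
        }).ncard : ℝ) ≤ (ε * (U.card : ℝ))^k := by
  classical
  have hkR : (k : ℝ) ≠ 0 := by positivity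
  have hroot : (1 : ℝ) ≤ (2 : ℝ) ^ ((1 : ℝ) / (k : ℝ)) :=
    Real.one_le_rpow (by norm_num) (by positivity)
  have hc0 : 0 < c := by rw [hc]; positivity
  rcases B.eq_empty_or_nonempty with rfl | hB
  · refine ⟨A, subset_rfl, ?_, ?_⟩
    · have hc1 : c ≤ 1 := by
        rw [hc]
        exact div_le_one_of_le₀ ((pow_le_one₀ hd0.le hd1).trans hroot) (by positivity)
      exact mul_le_of_le_one_left (by positivity) hc1
    · simp
      positivity
  have hck : 2 * c ^ k = (d ^ k) ^ k := by
    rw [hc, div_pow, ← Real.rpow_natCast ((2 : ℝ) ^ _) k, ← Real.rpow_mul (by norm_num),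
      one_div_mul_cancel hkR, Real.rpow_one]
    ring
  have hedges : {p : α × β | p.1 ∈ A ∧ p.2 ∈ B ∧ E p.1 p.2}.ncard =
      ∑ a ∈ A, (B.filter (E a)).card := by
    rw [← Finset.card_sigma, ← Set.ncard_coe_finset]
    refine Set.ncard_congr (fun p _ => ⟨p.1, p.2⟩) ?_ ?_ ?_
    · simp
    · rintro ⟨a, b⟩ ⟨a', b'⟩ - - h
      simpa using h
    · rintro ⟨a, b⟩ h
      exact ⟨(a, b), by simpa using h, rfl⟩
  obtain ⟨U, hUA, hU⟩ := exists_pow_add_card_bad_le hk hd0.le hc0.le hck hε0.le A B hB E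
    (by rw [hedges] at he; push_cast at he; linarith)
  refine ⟨U, hUA, ?_, ?_⟩
  · have h : (ε * (c * A.card)) ^ k ≤ (ε * U.card) ^ k :=
      le_trans (le_add_of_nonneg_right (by positivity)) hU
    exact le_of_mul_le_mul_left (le_of_pow_le_pow_left₀ (by lia) (by positivity) h) hε0
  · refine le_trans (le_of_eq ?_) (le_trans (le_add_of_nonneg_left (by positivity)) hU)
    have hcommon (f : Fin k → α) : {b | b ∈ B ∧ ∀ i, E (f i) b}.ncard =
        (B.filter fun b => ∀ i, E (f i) b).card := by
      rw [← Set.ncard_coe_finset, Finset.coe_filter]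
    norm_cast
    rw [← Set.ncard_coe_finset (Finset.filter _ _)]
    congr 1
    ext f
    simp [hcommon]

end Paper
end

section
/- For every integer k ≥ 2 there exist ξ > 0 and n₀ ∈ ℕ such that for every n ≥ n₀ the following holds: if G is an n-vertex oriented graph with minimum semi-degree δ⁰(G) ≥ (1/2 − 1/(4·3^{3k+2}))n, then every vertex x ∈ V(G) has at least ξ·n^{2k} k-absorbers in G. -/
namespace Paper

section Counting

open Finset
open scoped Classical

variable {α : Type*}

/-- The transitive `m`-tuples of `G` with all entries in `S`. -/
noncomputable def transTuples [Fintype α] (G : α → α → Prop) (m : ℕ) (S : Finset α) :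
    Finset (Fin m → α) :=
  {f | (∀ i, f i ∈ S) ∧ ∀ i j, i < j → G (f i) (f j)}

/-- A reverse Markov inequality: a bounded function with large sum is often large. -/
lemma sum_le_mul_card_add_mul_card_filter (S : Finset α) (f : α → ℝ) (θ M : ℝ)
    (hM : ∀ v ∈ S, f v ≤ M) :
    ∑ v ∈ S, f v ≤ θ * #S + (M - θ) * #{v ∈ S | θ ≤ f v} := by
  have h : ∀ v ∈ S, f v ≤ θ + (M - θ) * (if θ ≤ f v then 1 else 0) := by
    intro v hv
    have := hM v hv
    split_ifs with h <;> linarith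
  refine (sum_le_sum h).trans (le_of_eq ?_)
  rw [sum_add_distrib, ← mul_sum]
  simp [mul_comm]

lemma sum_card_out_eq_sum_card_in {β : Type*} (R : α → β → Prop) (S : Finset α) (T : Finset β) :
    ∑ v ∈ S, (#{w ∈ T | R v w} : ℝ) = ∑ w ∈ T, (#{v ∈ S | R v w} : ℝ) := by
  exact_mod_cast sum_card_bipartiteAbove_eq_sum_card_bipartiteBelow R

/-- A large vertex set of an almost complete digraph contains a positive proportion of
transitive `m`-tuples; `a` bounds the number of non-neighbours of each vertex. -/
lemma exists_mul_card_pow_le_card_transTuples (m : ℕ) (hm : 1 ≤ m) :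
    ∃ c : ℝ, 0 < c ∧ ∀ (α : Type) [Fintype α] (G : α → α → Prop) (a : ℝ),
      0 ≤ a →
      (∀ (S : Finset α) (v : α), (#S : ℝ) - a ≤ #{w ∈ S | G v w} + #{w ∈ S | G w v}) →
      ∀ S : Finset α, 3 ^ m * a ≤ #S → c * (#S : ℝ) ^ m ≤ #(transTuples G m S) := by
  induction m, hm using Nat.le_induction with
  | base =>
    refine ⟨1, one_pos, fun α _ G a _ _ S _ => ?_⟩
    have : #S ≤ #(transTuples G 1 S) := by
      refine card_le_card_of_injOn (fun s _ => s) ?_ ?_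
      · intro s hs
        have hs' : s ∈ S := hs
        simp [transTuples, hs']
      · intro s _ t _ h
        exact congrFun h 0
    simpa using this
  | succ m hm ih =>
    obtain ⟨c, hc, ih⟩ := ih
    refine ⟨1 / 6 * (c * (1 / 3) ^ m), by positivity, fun α _ G a ha hG S hS => ?_⟩
    have hsa : 9 * a ≤ #S := by
      refine le_trans ?_ hS
      have : (3 : ℝ) ^ 2 ≤ 3 ^ (m + 1) := pow_le_pow_right₀ (by norm_num) (by omega)
      nlinarith
    set s : ℝ := (#S : ℝ) with hs
    have hs0 : 0 ≤ s := by positivity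
    set L : Finset α := {v ∈ S | s / 3 ≤ (#{w ∈ S | G v w} : ℝ)} with hL
    have hsum : s * (s - a) ≤ 2 * ∑ v ∈ S, (#{w ∈ S | G v w} : ℝ) := by
      have h := sum_le_sum (fun v (_ : v ∈ S) => hG S v)
      rw [sum_add_distrib, ← sum_card_out_eq_sum_card_in G S S] at h
      simp at h
      linarith
    have hLcard : s / 6 ≤ #L := by
      have h := sum_le_mul_card_add_mul_card_filter S (fun v => (#{w ∈ S | G v w} : ℝ)) (s / 3) s
        (fun v _ => by rw [hs]; exact_mod_cast card_filter_le _ _)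
      rw [← hL, ← hs] at h
      rcases hs0.eq_or_lt with h0 | h0
      · rw [← h0]; simp
      · have : s * (s / 6) ≤ s * #L := by nlinarith
        exact le_of_mul_le_mul_left this h0
    have hcons : ∑ v ∈ L, #(transTuples G m {w ∈ S | G v w}) ≤ #(transTuples G (m + 1) S) := by
      rw [← card_sigma]
      refine card_le_card_of_injOn (fun p => Fin.cons p.1 p.2) ?_ ?_
      · rintro ⟨v, f⟩ hp
        simp only [hL, transTuples, coe_sigma, Set.mem_sigma_iff, mem_coe, mem_filter,
          mem_univ, true_and] at hp
        simp only [transTuples, mem_coe, mem_filter, mem_univ, true_and]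
        refine ⟨fun i => ?_, fun i j => ?_⟩
        · refine Fin.cases ?_ (fun i => ?_) i
          · exact hp.1.1
          · exact (hp.2.1 i).1
        · refine Fin.cases ?_ (fun i => ?_) i <;> refine Fin.cases ?_ (fun j => ?_) j
          · simp
          · intro _; exact (hp.2.1 j).2
          · simp
          · intro h; exact hp.2.2 i j (by simpa using h)
      · rintro ⟨v, f⟩ _ ⟨w, g⟩ _ h
        obtain ⟨rfl, rfl⟩ := Fin.cons_injective2 h
        rfl
    have hterm : ∀ v ∈ L, c * (s / 3) ^ m ≤ (#(transTuples G m {w ∈ S | G v w}) : ℝ) := by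
      intro v hv
      have hv' : s / 3 ≤ (#{w ∈ S | G v w} : ℝ) := (mem_filter.1 hv).2
      refine le_trans ?_ (ih α G a ha hG _ (le_trans ?_ hv'))
      · gcongr
      · rw [pow_succ] at hS; linarith
    calc 1 / 6 * (c * (1 / 3) ^ m) * s ^ (m + 1) = s / 6 * (c * (s / 3) ^ m) := by
          rw [div_pow, div_pow, one_pow]; ring
      _ ≤ #L * (c * (s / 3) ^ m) := by gcongr
      _ ≤ ∑ v ∈ L, (#(transTuples G m {w ∈ S | G v w}) : ℝ) := by
          have h := sum_le_sum hterm
          simpa using h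
      _ ≤ _ := by exact_mod_cast hcons

/-- Few tuples can have a prescribed subtuple in a given set. -/
lemma card_filter_comp_mem_le [Fintype α] {k l m : ℕ} (hm : m = k + l) (e : Fin k → Fin m)
    (he : Function.Injective e) (A : Finset (Fin k → α)) :
    #{T : Fin m → α | T ∘ e ∈ A} ≤ #A * Fintype.card α ^ l := by
  have hcompl : Fintype.card {j : Fin m // j ∉ Set.range e} = l := by
    rw [Fintype.card_subtype_compl]
    have : Fintype.card {j : Fin m // j ∈ Set.range e} = k := by
      rw [← Nat.card_eq_fintype_card]
      exact (Nat.card_range_of_injective he).trans (Nat.card_fin k)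
    rw [this]; simp; omega
  have : #A * Fintype.card α ^ l =
      #(A ×ˢ (univ : Finset ({j : Fin m // j ∉ Set.range e} → α))) := by
    rw [card_product, card_univ, Fintype.card_fun, hcompl]
  rw [this]
  refine card_le_card_of_injOn (fun T => (T ∘ e, fun j => T j.1)) ?_ ?_
  · intro T hT
    simpa using hT
  · intro T _ T' _ h
    simp only [Prod.mk.injEq] at h
    funext j
    by_cases hj : j ∈ Set.range e
    · obtain ⟨i, rfl⟩ := hj
      exact congrFun h.1 i
    · exact congrFun h.2 ⟨j, hj⟩

lemma card_orderEmb_le (k : ℕ) : Fintype.card (Fin k ↪o Fin (3 * k)) ≤ 8 ^ k := by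
  have h : Fintype.card (Fin k ↪o Fin (3 * k)) ≤ Fintype.card (Finset (Fin (3 * k))) := by
    refine Fintype.card_le_of_injective (fun e => univ.map e.toEmbedding) fun e e' h => ?_
    have h' : Set.range e = Set.range e' := by
      simpa using congrArg (fun s : Finset (Fin (3 * k)) => (s : Set (Fin (3 * k)))) h
    exact DFunLike.coe_injective ((e.strictMono.range_inj e'.strictMono).1 h')
  refine h.trans (le_of_eq ?_)
  rw [Fintype.card_finset, Fintype.card_fin, pow_mul]
  norm_num

/-- If every `T i` has many out-neighbours in `V`, then some `k` of the `3k` vertices `T i`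
have many common out-neighbours in `V`. -/
lemma exists_orderEmb_card_commonOut {β : Type*} (R : α → β → Prop) {k : ℕ} (hk : 1 ≤ k)
    (V : Finset β) (N : ℝ) (T : Fin (3 * k) → α)
    (hT : ∀ i, N / 5 ≤ (#{v ∈ V | R (T i) v} : ℝ)) :
    ∃ e : Fin k ↪o Fin (3 * k),
      (3 / 5 * N - #V) / 2 ≤ 8 ^ k * (#{v ∈ V | ∀ i, R (T (e i)) v} : ℝ) := by
  have hk0 : (0 : ℝ) < k := by exact_mod_cast hk
  set W : Finset β := {v ∈ V | (k : ℝ) ≤ (#{i | R (T i) v} : ℝ)} with hW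
  have hWcard : (3 / 5 * N - #V) / 2 ≤ #W := by
    have h := sum_le_mul_card_add_mul_card_filter V (fun v => (#{i | R (T i) v} : ℝ)) k (3 * k)
      (fun v _ => by
        have := card_le_univ ({i | R (T i) v} : Finset (Fin (3 * k)))
        simp only [Fintype.card_fin] at this
        exact_mod_cast this)
    rw [← sum_card_out_eq_sum_card_in (fun i v => R (T i) v) univ V, ← hW] at h
    have h' := sum_le_sum (fun i (_ : i ∈ (univ : Finset (Fin (3 * k)))) => hT i)
    simp at h'
    have : (k : ℝ) * ((3 / 5 * N - #V) / 2) ≤ k * #W := by linarith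
    exact le_of_mul_le_mul_left this hk0
  set C : Finset (Fin (3 * k)) → Finset β := fun I => {v ∈ V | ∀ i ∈ I, R (T i) v} with hC
  have hcover : W ⊆ (powersetCard k univ).biUnion C := by
    intro v hv
    rw [hW, mem_filter] at hv
    obtain ⟨I, hI, hIk⟩ := exists_subset_card_eq (Nat.cast_le.1 hv.2)
    simp only [mem_biUnion, mem_powersetCard, hC, mem_filter]
    exact ⟨I, ⟨subset_univ _, hIk⟩, hv.1, fun i hi => by simpa using hI hi⟩
  have hsum : #W ≤ ∑ I ∈ powersetCard k univ, #(C I) :=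
    (card_le_card hcover).trans card_biUnion_le
  have hne : (powersetCard k (univ : Finset (Fin (3 * k)))).Nonempty := by
    rw [powersetCard_nonempty]; simp; omega
  obtain ⟨I, hI, hmax⟩ := exists_max_image _ (fun I => #(C I)) hne
  have hWI : #W ≤ 8 ^ k * #(C I) := by
    calc #W ≤ ∑ J ∈ powersetCard k univ, #(C J) := hsum
      _ ≤ #(powersetCard k (univ : Finset (Fin (3 * k)))) * #(C I) := by
          simpa using sum_le_card_nsmul _ _ _ hmax
      _ ≤ 8 ^ k * #(C I) := by
          gcongr
          rw [card_powersetCard, card_univ, Fintype.card_fin]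
          refine (Nat.choose_le_two_pow _ _).trans (le_of_eq ?_)
          rw [pow_mul]; norm_num
  refine ⟨I.orderEmbOfFin (mem_powersetCard.1 hI).2, hWcard.trans ?_⟩
  have hsub : C I ⊆ {v ∈ V | ∀ i, R (T (I.orderEmbOfFin (mem_powersetCard.1 hI).2 i)) v} := by
    intro v hv
    rw [hC, mem_filter] at hv
    exact mem_filter.2 ⟨hv.1, fun i => hv.2 _ (orderEmbOfFin_mem _ _ _)⟩
  calc (#W : ℝ) ≤ 8 ^ k * #(C I) := by exact_mod_cast hWI
    _ ≤ _ := by gcongr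

/-- The pairs of transitive `k`-tuples in `U` and in `V` with all edges from the first tuple
to the second. -/
noncomputable def joinedPairs [Fintype α] (G : α → α → Prop) (k : ℕ) (U V : Finset α) :
    Finset ((Fin k → α) × (Fin k → α)) :=
  {p ∈ transTuples G k U ×ˢ transTuples G k V | ∀ i j, G (p.1 i) (p.2 j)}

/-- If every vertex of a large set `U` has many out-neighbours in `V`, then there are many
joined pairs. -/
lemma exists_mul_pow_le_card_joinedPairs (k : ℕ) (hk : 2 ≤ k) :
    ∃ ξ : ℝ, 0 < ξ ∧ ∀ (α : Type) [Fintype α] [Nonempty α] (G : α → α → Prop) (N : ℝ),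
      N = Fintype.card α →
      (∀ (S : Finset α) (v : α), (#S : ℝ) - N / (2 * 3 ^ (3 * k + 2)) ≤
        #{w ∈ S | G v w} + #{w ∈ S | G w v}) →
      ∀ U V : Finset α, N / 18 ≤ #U → #V ≤ 501 / 1000 * N →
      (∀ u ∈ U, N / 5 ≤ #{v ∈ V | G u v}) →
      ξ * N ^ (2 * k) ≤ #(joinedPairs G k U V) := by
  obtain ⟨c, hc, hcount⟩ := exists_mul_card_pow_le_card_transTuples (3 * k) (by omega)
  obtain ⟨d, hd, hdcount⟩ := exists_mul_card_pow_le_card_transTuples k (by omega)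
  set γ : ℝ := d * (1 / (18 * 9 ^ k)) ^ k with hγ
  have hγ0 : 0 < γ := by positivity
  refine ⟨c * (1 / 18) ^ (3 * k) / 8 ^ k * γ, by positivity, ?_⟩
  intro α _ _ G N hN hG U V hU hV hUV
  have hN0 : 0 < N := by rw [hN]; exact_mod_cast Fintype.card_pos
  have ha0 : 0 ≤ N / (2 * 3 ^ (3 * k + 2)) := by positivity
  set W : (Fin k → α) → Finset (Fin k → α) :=
    fun u => transTuples G k {v ∈ V | ∀ i, G (u i) v} with hW
  set A : Finset (Fin k → α) := {u ∈ transTuples G k U | γ * N ^ k ≤ (#(W u) : ℝ)} with hA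
  have hgood : ∀ T ∈ transTuples G (3 * k) U, ∃ e : Fin k ↪o Fin (3 * k), T ∘ e ∈ A := by
    intro T hT
    simp only [transTuples, mem_filter, mem_univ, true_and] at hT
    obtain ⟨e, he⟩ := exists_orderEmb_card_commonOut G (by omega) V N T
      (fun i => hUV _ (hT.1 i))
    refine ⟨e, ?_⟩
    rw [hA, mem_filter]
    refine ⟨?_, ?_⟩
    · simp only [transTuples, mem_filter, mem_univ, true_and]
      exact ⟨fun i => hT.1 _, fun i j hij => hT.2 _ _ (e.lt_iff_lt.2 hij)⟩
    · have h98 : (6 : ℝ) / 5 * 8 ^ k ≤ 9 ^ k := by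
        have h := pow_le_pow_right₀ (show (1 : ℝ) ≤ 9 / 8 by norm_num) hk
        rw [div_pow 9 8 k, le_div_iff₀ (by positivity)] at h
        nlinarith [show (0 : ℝ) < 8 ^ k by positivity]
      have hX : N / (18 * 9 ^ k) ≤ (#{v ∈ V | ∀ i, G ((T ∘ e) i) v} : ℝ) := by
        set X : ℝ := (#{v ∈ V | ∀ i, G (T (e i)) v} : ℝ)
        have hX0 : (0 : ℝ) ≤ X := Nat.cast_nonneg _
        change _ ≤ X
        rw [div_le_iff₀ (by positivity)]
        have : (6 : ℝ) / 5 * 8 ^ k * X ≤ 9 ^ k * X := by gcongr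
        nlinarith
      have ha : 3 ^ k * (N / (2 * 3 ^ (3 * k + 2))) = N / (18 * 9 ^ k) := by
        rw [show (9 : ℝ) ^ k = 3 ^ k * 3 ^ k by rw [← mul_pow]; norm_num,
          show (3 : ℝ) ^ (3 * k + 2) = 9 * (3 ^ k * (3 ^ k * 3 ^ k)) by ring]
        field_simp
        norm_num
      refine le_trans ?_ (hdcount α G _ ha0 hG _ (ha.trans_le hX))
      calc γ * N ^ k = d * (N / (18 * 9 ^ k)) ^ k := by
            rw [hγ, mul_assoc, ← mul_pow, one_div_mul_eq_div]
        _ ≤ _ := by gcongr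
  have hAcard : c * (1 / 18) ^ (3 * k) / 8 ^ k * N ^ k ≤ #A := by
    have hlow : c * (N / 18) ^ (3 * k) ≤ #(transTuples G (3 * k) U) := by
      refine le_trans ?_ (hcount α G _ ha0 hG U (le_trans (le_of_eq ?_) hU))
      · gcongr
      · rw [pow_add]
        field_simp
        norm_num
    have hcover : transTuples G (3 * k) U ⊆
        (univ : Finset (Fin k ↪o Fin (3 * k))).biUnion fun e => {T | T ∘ e ∈ A} := by
      intro T hT
      obtain ⟨e, he⟩ := hgood T hT
      simpa using ⟨e, he⟩
    have hup : #(transTuples G (3 * k) U) ≤ 8 ^ k * (#A * Fintype.card α ^ (2 * k)) := by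
      calc _ ≤ _ := (card_le_card hcover).trans card_biUnion_le
        _ ≤ Fintype.card (Fin k ↪o Fin (3 * k)) * (#A * Fintype.card α ^ (2 * k)) := by
            have h := sum_le_sum fun (e : Fin k ↪o Fin (3 * k)) (_ : e ∈ univ) =>
              card_filter_comp_mem_le (show 3 * k = k + 2 * k by ring) e e.injective A
            simpa only [sum_const, smul_eq_mul, card_univ] using h
        _ ≤ _ := by
            gcongr
            exact card_orderEmb_le k
    have hup' : (#(transTuples G (3 * k) U) : ℝ) ≤ 8 ^ k * (#A * N ^ (2 * k)) := by
      rw [hN]; exact_mod_cast hup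
    have hpos : (0 : ℝ) < 8 ^ k * N ^ (2 * k) := by positivity
    refine le_of_mul_le_mul_left ?_ hpos
    calc 8 ^ k * N ^ (2 * k) * (c * (1 / 18) ^ (3 * k) / 8 ^ k * N ^ k)
        = c * (N / 18) ^ (3 * k) := by
          rw [div_eq_mul_one_div N, mul_pow, show 3 * k = 2 * k + k by ring, pow_add N]
          field_simp
      _ ≤ _ := hlow.trans hup'
      _ = _ := by ring
  have hsigma : ∑ u ∈ A, #(W u) ≤ #(joinedPairs G k U V) := by
    rw [← card_sigma]
    refine card_le_card_of_injOn (fun p => (p.1, p.2)) ?_ ?_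
    · rintro ⟨u, v⟩ hp
      simp only [hA, hW, transTuples, coe_sigma, Set.mem_sigma_iff, mem_coe, mem_filter,
        mem_univ, true_and] at hp
      simp only [joinedPairs, transTuples, mem_coe, mem_filter, mem_product, mem_univ, true_and]
      exact ⟨⟨hp.1.1, fun i => (hp.2.1 i).1, hp.2.2⟩, fun i j => (hp.2.1 j).2 i⟩
    · rintro ⟨u, v⟩ _ ⟨u', v'⟩ _ h
      simp only [Prod.mk.injEq] at h
      obtain ⟨rfl, rfl⟩ := h
      rfl
  calc c * (1 / 18) ^ (3 * k) / 8 ^ k * γ * N ^ (2 * k)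
      = c * (1 / 18) ^ (3 * k) / 8 ^ k * N ^ k * (γ * N ^ k) := by ring
    _ ≤ #A * (γ * N ^ k) := by gcongr
    _ ≤ ∑ u ∈ A, (#(W u) : ℝ) := by
        have h := sum_le_sum (fun u (hu : u ∈ A) => (mem_filter.1 hu).2)
        simpa using h
    _ ≤ _ := by exact_mod_cast hsigma

/-- In an almost complete oriented graph, if `U` and `V` nearly partition the vertex set into
halves, then a positive proportion of `U` has many out-neighbours in `V`. -/
lemma card_filter_out_ge [Fintype α] [Nonempty α] (G : α → α → Prop)
    (hG : ∀ u v, G u v → ¬ G v u) (N ε : ℝ) (hN : N = Fintype.card α) (hε : ε ≤ 1 / 1000)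
    (hout : ∀ v, (1 / 2 - ε) * N ≤ #{w | G v w}) (U V : Finset α) (hUV : Disjoint U V)
    (hU : (1 / 2 - ε) * N ≤ #U) (hV : (1 / 2 - ε) * N ≤ #V) :
    N / 18 ≤ #{u ∈ U | N / 5 ≤ (#{v ∈ V | G u v} : ℝ)} := by
  have hN0 : 0 < N := by rw [hN]; exact_mod_cast Fintype.card_pos
  have hcard : (#U : ℝ) + #V ≤ N := by
    rw [hN]; exact_mod_cast (card_union_of_disjoint hUV).symm.trans_le (card_le_univ _)
  have hinside : 2 * ∑ u ∈ U, (#{w ∈ U | G u w} : ℝ) ≤ #U * #U := by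
    have h : ∀ u ∈ U, (#{w ∈ U | G u w} : ℝ) + #{w ∈ U | G w u} ≤ #U := by
      intro u _
      have hd : Disjoint {w ∈ U | G u w} {w ∈ U | G w u} :=
        disjoint_filter.2 fun w _ h => hG _ _ h
      have h := card_le_card (union_subset (filter_subset (G u) U) (filter_subset (G · u) U))
      rw [card_union_of_disjoint hd] at h
      exact_mod_cast h
    have h' := sum_le_sum h
    rw [sum_add_distrib, ← sum_card_out_eq_sum_card_in G U U] at h'
    simp at h'
    linarith
  have hsplit : ∀ u ∈ U, (1 / 2 - ε) * N - (N - #U - #V) - #{w ∈ U | G u w} ≤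
      (#{w ∈ V | G u w} : ℝ) := by
    intro u _
    have hsub : ({w | G u w} : Finset α) ⊆
        {w ∈ U | G u w} ∪ {w ∈ V | G u w} ∪ (U ∪ V)ᶜ := by
      intro w hw
      have hw' : G u w := by simpa using hw
      simp only [mem_union, mem_filter, mem_compl]
      tauto
    have h := (card_le_card hsub).trans
      ((card_union_le _ _).trans (Nat.add_le_add_right (card_union_le _ _) _))
    have hc := card_add_card_compl (U ∪ V)
    rw [card_union_of_disjoint hUV] at hc
    have h' : (#{w | G u w} : ℝ) ≤ #{w ∈ U | G u w} + #{w ∈ V | G u w} + #(U ∪ V)ᶜ := by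
      exact_mod_cast h
    have hc' : (#U : ℝ) + #V + #(U ∪ V)ᶜ = N := by rw [hN]; exact_mod_cast hc
    linarith [hout u]
  have hsum := sum_le_sum hsplit
  rw [sum_sub_distrib] at hsum
  simp only [sum_const, nsmul_eq_mul] at hsum
  have hrev := sum_le_mul_card_add_mul_card_filter U (fun u => (#{v ∈ V | G u v} : ℝ)) (N / 5) #V
    (fun u _ => by exact_mod_cast card_filter_le _ _)
  set q : ℝ := (#{u ∈ U | N / 5 ≤ (#{v ∈ V | G u v} : ℝ)} : ℝ)
  have hq : (0 : ℝ) ≤ q := Nat.cast_nonneg _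
  set s : ℝ := (#U : ℝ)
  set t : ℝ := (#V : ℝ)
  have hεN : ε * N ≤ N / 1000 := by nlinarith
  have hs : 499 / 1000 * N ≤ s := by linarith
  have ht : 499 / 1000 * N ≤ t := by linarith
  have hmain : s * (46 / 1000 * N) ≤ (t - N / 5) * q := by
    have : s * (46 / 1000 * N) ≤
        s * ((1 / 2 - ε) * N - (N - s - t)) - s * s / 2 - N / 5 * s := by
      have : s * (46 / 1000 * N) ≤
          s * ((1 / 2 - ε) * N - (N - s - t) - s / 2 - N / 5) := by
        gcongr
        linarith
      linarith
    linarith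
  have h1 : 499 / 1000 * N * (46 / 1000 * N) ≤ s * (46 / 1000 * N) := by gcongr
  have h2 : (t - N / 5) * q ≤ 301 / 1000 * N * q := by
    gcongr
    linarith
  have h3 : N * (499 / 1000 * (46 / 1000 * N)) ≤ N * (301 / 1000 * q) := by linarith
  linarith [le_of_mul_le_mul_left h3 hN0]

/-- The number of non-neighbours of a vertex in a set `S` is at most that in the whole graph. -/
lemma card_sub_le_card_out_add_card_in [Fintype α] (G : α → α → Prop) (a : ℝ) (v : α)
    (h : (Fintype.card α : ℝ) - a ≤ #{w | G v w} + #{w | G w v})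
    (hG : ∀ u v, G u v → ¬ G v u) (S : Finset α) :
    (#S : ℝ) - a ≤ #{w ∈ S | G v w} + #{w ∈ S | G w v} := by
  have key : ∀ S : Finset α,
      #S = #{w ∈ S | G v w} + #{w ∈ S | G w v} + #{w ∈ S | ¬ (G v w ∨ G w v)} := by
    intro S
    have hd : Disjoint {w ∈ S | G v w} {w ∈ S | G w v} :=
      disjoint_filter.2 fun w _ h => hG _ _ h
    rw [← card_union_of_disjoint hd, ← filter_or, card_filter_add_card_filter_not]
  have hu : (Fintype.card α : ℝ) =
      #{w | G v w} + #{w | G w v} + #{w | ¬ (G v w ∨ G w v)} := by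
    exact_mod_cast key univ
  have hS : (#S : ℝ) =
      #{w ∈ S | G v w} + #{w ∈ S | G w v} + #{w ∈ S | ¬ (G v w ∨ G w v)} := by
    exact_mod_cast key S
  have hmono : (#{w ∈ S | ¬ (G v w ∨ G w v)} : ℝ) ≤ #{w | ¬ (G v w ∨ G w v)} := by
    exact_mod_cast card_le_card (filter_subset_filter _ (subset_univ S))
  linarith

/-- A list all of whose ordered pairs are edges is a `k`-path. -/
lemma IsKPath.of_pairwise {n : ℕ} {G : Fin n → Fin n → Prop} (hG : IsOriented G) (k : ℕ)
    {P : List (Fin n)} (hP : P.Pairwise G) : IsKPath k G P := by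
  refine ⟨hP.imp ?_, fun i j hij _ => List.pairwise_iff_get.1 hP i j hij⟩
  rintro u v huv rfl
  exact hG _ _ huv huv

/-- Joined pairs between the in- and out-neighbourhood of `x` give absorbers for `x`. -/
lemma card_joinedPairs_le_ncard_absorbers {n : ℕ} {G : Fin n → Fin n → Prop} (hG : IsOriented G)
    (k : ℕ) (x : Fin n) (U V : Finset (Fin n)) (hU : ∀ u ∈ U, G u x) (hV : ∀ v ∈ V, G x v) :
    #(joinedPairs G k U V) ≤ {P : List (Fin n) | P.length = 2 * k ∧ IsKPath k G P ∧ x ∉ P ∧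
      IsKPath k G (P.take k ++ x :: P.drop k)}.ncard := by
  have hinj : Function.Injective fun p : (Fin k → Fin n) × (Fin k → Fin n) =>
      List.ofFn p.1 ++ List.ofFn p.2 := by
    rintro ⟨u, v⟩ ⟨u', v'⟩ h
    have h' := List.append_inj h (by simp)
    exact Prod.ext (List.ofFn_injective h'.1) (List.ofFn_injective h'.2)
  rw [← Set.ncard_coe_finset, ← Set.ncard_image_of_injective _ hinj]
  refine Set.ncard_le_ncard ?_ ((List.finite_length_eq (Fin n) (2 * k)).subset fun P hP => hP.1)
  rintro _ ⟨⟨u, v⟩, hp, rfl⟩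
  simp only [joinedPairs, transTuples, mem_coe, mem_filter, mem_product, mem_univ,
    true_and] at hp
  obtain ⟨⟨⟨huU, hu⟩, hvV, hv⟩, huv⟩ := hp
  have hupw : (List.ofFn u).Pairwise G := List.pairwise_ofFn.2 fun i j => hu i j
  have hvpw : (List.ofFn v).Pairwise G := List.pairwise_ofFn.2 fun i j => hv i j
  have hloop : ∀ w, ¬ G w w := fun w h => hG _ _ h h
  refine ⟨?_, IsKPath.of_pairwise hG k ?_, ?_, IsKPath.of_pairwise hG k ?_⟩
  · simp; ring
  · refine List.pairwise_append.2 ⟨hupw, hvpw, ?_⟩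
    simpa [List.mem_ofFn] using huv
  · simp only [List.mem_append, List.mem_ofFn]
    rintro (⟨i, rfl⟩ | ⟨i, rfl⟩)
    · exact hloop _ (hU _ (huU i))
    · exact hloop _ (hV _ (hvV i))
  · rw [List.take_left' (by simp), List.drop_left' (by simp)]
    refine List.pairwise_append.2 ⟨hupw, List.pairwise_cons.2 ⟨?_, hvpw⟩, ?_⟩
    · simpa [List.mem_ofFn] using fun i => hV _ (hvV i)
    · simpa [List.mem_ofFn] using fun i => ⟨hU _ (huU i), huv i⟩

end Counting

/-- Absorbing lemma for oriented graphs: for every `k ≥ 2` there are `ξ > 0` and `n₀` such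
that in every oriented graph on `n ≥ n₀` vertices with minimum semi-degree at least
`(1/2 - 1/(4·3^(3k+2)))n`, every vertex `x` has at least `ξ n^(2k)` `k`-absorbers, i.e.
`k`-paths `P` on `2k` vertices avoiding `x` such that inserting `x` in the middle of `P`
again yields a `k`-path. -/
theorem statement_15 (k : ℕ) (hk : 2 ≤ k) :
    ∃ (ξ : ℝ) (n₀ : ℕ), 0 < ξ ∧ ∀ n : ℕ, n₀ ≤ n → ∀ G : Fin n → Fin n → Prop,
      IsOriented G →
      (∀ v, (1/2 - 1/(4 * (3:ℝ)^(3*k+2))) * n ≤ ((min (outDeg G v) (inDeg G v) : ℕ) : ℝ)) →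
      ∀ x : Fin n,
        ξ * (n:ℝ)^(2*k) ≤
          (({P : List (Fin n) | P.length = 2*k ∧ IsKPath k G P ∧ x ∉ P ∧
            IsKPath k G (P.take k ++ x :: P.drop k)}).ncard : ℝ) := by
  classical
  obtain ⟨ξ, hξ, hmain⟩ := exists_mul_pow_le_card_joinedPairs k hk
  refine ⟨ξ, 0, hξ, fun n _ G hG hdeg x => ?_⟩
  have : Nonempty (Fin n) := ⟨x⟩
  set ε : ℝ := 1 / (4 * (3 : ℝ) ^ (3 * k + 2)) with hε
  have hε' : ε ≤ 1 / 1000 := by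
    have : (3 : ℝ) ^ 8 ≤ 3 ^ (3 * k + 2) := pow_le_pow_right₀ (by norm_num) (by omega)
    exact one_div_le_one_div_of_le (by norm_num) (by linarith)
  have hn0 : (0 : ℝ) ≤ n := Nat.cast_nonneg n
  have hout : ∀ v, (1 / 2 - ε) * n ≤ (Finset.card {w | G v w} : ℝ) := by
    intro v
    refine (hdeg v).trans (Nat.cast_le.2 ((min_le_left _ _).trans (le_of_eq ?_)))
    rw [outDeg, ← Set.ncard_coe_finset]
    simp
  have hin : ∀ v, (1 / 2 - ε) * n ≤ (Finset.card {w | G w v} : ℝ) := by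
    intro v
    refine (hdeg v).trans (Nat.cast_le.2 ((min_le_right _ _).trans (le_of_eq ?_)))
    rw [inDeg, ← Set.ncard_coe_finset]
    simp
  set U : Finset (Fin n) := {w | G w x} with hU
  set V : Finset (Fin n) := {w | G x w} with hV
  have hUV : Disjoint U V := Finset.disjoint_filter.2 fun w _ h => hG _ _ h
  have hcard : (U.card : ℝ) + V.card ≤ n := by
    have h := (Finset.card_union_of_disjoint hUV).symm.trans_le (Finset.card_le_univ _)
    rw [Fintype.card_fin] at h
    exact_mod_cast h
  have hVcard : (V.card : ℝ) ≤ 501 / 1000 * n := by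
    have := hin x
    nlinarith
  have hUlarge := card_filter_out_ge G hG n ε (by simp) hε' hout U V hUV (hin x) (hout x)
  have hnonadj : ∀ (S : Finset (Fin n)) (v : Fin n),
      (S.card : ℝ) - n / (2 * 3 ^ (3 * k + 2)) ≤
        (S.filter (G v ·)).card + (S.filter (G · v)).card := by
    intro S v
    refine card_sub_le_card_out_add_card_in G _ v ?_ hG S
    have : (n : ℝ) / (2 * 3 ^ (3 * k + 2)) = 2 * ε * n := by
      rw [hε]
      field_simp
      norm_num
    rw [this, Fintype.card_fin]
    linarith [hout v, hin v]
  refine (hmain (Fin n) G n (by simp) (fun S v => ?_) _ V ?_ hVcard ?_).trans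
    (Nat.cast_le.2 (card_joinedPairs_le_ncard_absorbers hG k x
      (U.filter fun u => (n : ℝ) / 5 ≤ ((V.filter (G u ·)).card : ℝ)) V ?_ ?_))
  · convert hnonadj S v
  · convert hUlarge
  · intro u hu
    convert (Finset.mem_filter.1 hu).2
  · intro u hu
    simpa [hU] using (Finset.mem_filter.1 hu).1
  · intro v hv
    simpa [hV] using hv

end Paper
end
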